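/- Set H_a = J_a + ω_a − 4ω_a² in A(𝓗^+). Then for distinct a and b the following relations hold in A(𝓗^+): (70H_a + 1188ω_a² − 585ω_a + 27)H_a = 0; (ω_a − 1)(ω_a − 1/16)(ω_a − 9/16)H_a = 0; −(2/9)H_a + (2/9)H_b = 2E^u_{aa} − 2E^u_{bb} + (1/4)E^t_{aa} − (1/4)E^t_{bb}; −(4/135)(2ω_a + 13)H_a + (4/135)(2ω_b + 13)H_b = 4E^u_{aa} − 4E^u_{bb} + (15/32)E^t_{aa} − (15/32)E^t_{bb}; ω_b H_a = −(2/15)(ω_a − 1)H_a + (1/15)(ω_b − 1)H_b; Λ_{ab}² = 4ω_aω_b − (1/9)(H_a + H_b) − (E^u_{aa} + E^u_{bb}) − (1/4)(E^t_{aa} + E^t_{bb}); and, for a,b,c distinct, Λ_{ab}*Λ_{bc} = 2ω_b*Λ_{ac}. -/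

import Mathlib

/-!
Common framework: vertex operator algebras over ℂ encoded via their modes,
weak/admissible/ordinary modules, twisted modules, Zhu's algebra data,
and the free bosonic (Heisenberg) vertex operator algebra `𝓗 = M(1)` of rank `ℓ`
together with its `θ`-fixed subalgebra `𝓗⁺`.
-/

open scoped BigOperators DirectSum TensorProduct

noncomputable section

/-- Generalized binomial coefficient `(q choose n)` for `q : ℚ`. -/
def qchoose (q : ℚ) : ℕ → ℚ
  | 0 => 1
  | n + 1 => qchoose q n * (q - n) / (n + 1)

/-- Generalized binomial coefficient of an integer, as a complex number. -/
def zchoose (m : ℤ) (n : ℕ) : ℂ := ((qchoose (m : ℚ) n : ℚ) : ℂ)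

/-- A vertex operator algebra over `ℂ`, encoded through its modes:
`Y u n : Module.End ℂ V` is the `n`-th mode `u_n` of the vertex operator `Y(u,z)`.
The axioms are: truncation, the vacuum and creation axioms, the (component form of
the) Jacobi/Borcherds identity, a lower-truncated `ℤ`-grading by `L(0)`-eigenvalues
with finite dimensional homogeneous pieces compatible with the modes, the Virasoro
relations for the conformal vector and the `L(-1)`-derivative (translation) axiom. -/
structure VOA (V : Type) [AddCommGroup V] [Module ℂ V] : Type where
  Y : V →ₗ[ℂ] ℤ → Module.End ℂ V
  one : V
  omega : V
  wt : ℤ → Submodule ℂ V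
  centralCharge : ℂ
  internal : DirectSum.IsInternal wt
  one_wt : one ∈ wt 0
  omega_wt : omega ∈ wt 2
  one_ne_zero : one ≠ 0
  fdim : ∀ n : ℤ, FiniteDimensional ℂ (wt n)
  bounded_below : ∃ N : ℤ, ∀ n : ℤ, n < N → wt n = ⊥
  trunc : ∀ u v : V, ∃ N : ℤ, ∀ n : ℤ, N ≤ n → Y u n v = 0
  vacuum_act : ∀ n : ℤ, Y one n = if n = -1 then (1 : Module.End ℂ V) else 0
  create : ∀ u : V, Y u (-1) one = u
  create_ge : ∀ (u : V) (n : ℤ), 0 ≤ n → Y u n one = 0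
  mode_wt : ∀ (k : ℤ) (u : V), u ∈ wt k → ∀ (m n : ℤ) (v : V), v ∈ wt m →
    Y u n v ∈ wt (m + k - n - 1)
  L0_diag : ∀ (n : ℤ) (v : V), v ∈ wt n → Y omega 1 v = (n : ℂ) • v
  translation : ∀ (u : V) (n : ℤ), Y (Y omega 0 u) n = (-(n : ℂ)) • Y u (n - 1)
  virasoro : ∀ m n : ℤ,
    Y omega (m + 1) * Y omega (n + 1) - Y omega (n + 1) * Y omega (m + 1)
      = ((m : ℂ) - (n : ℂ)) • Y omega (m + n + 1)
        + (if m + n = 0 then (((m ^ 3 - m : ℤ) : ℂ) / 12) * centralCharge else 0)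
            • (1 : Module.End ℂ V)
  borcherds : ∀ (u v w : V) (p m n : ℤ),
    ∑ᶠ i : ℕ, zchoose m i • Y (Y u (p + i) v) (m + n - i) w
      = ∑ᶠ i : ℕ, ((-1 : ℂ) ^ i * zchoose p i) •
          (Y u (m + p - i) (Y v (n + i) w)
            - ((-1 : ℂ) ^ p) • Y v (n + p - i) (Y u (m + i) w))

variable {V : Type} [AddCommGroup V] [Module ℂ V]

/-- Simplicity of a vertex operator algebra: the only subspaces invariant under
all modes are `0` and the whole space. -/
def VOA.Simple (A : VOA V) : Prop :=
  ∀ U : Submodule ℂ V, (∀ (u : V) (n : ℤ) (v : V), v ∈ U → A.Y u n v ∈ U) → U = ⊥ ∨ U = ⊤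

/-- The decomposition of a vertex operator algebra into its homogeneous pieces. -/
noncomputable def VOA.decompose (A : VOA V) : V ≃ₗ[ℂ] ⨁ n : ℤ, A.wt n :=
  (LinearEquiv.ofBijective (DirectSum.coeLinearMap A.wt) A.internal).symm

/-- The homogeneous component of weight `n` of a vector. -/
noncomputable def VOA.hcomp (A : VOA V) (n : ℤ) (u : V) : V := (A.decompose u n : V)

/-- Zhu's product `u * v` for `u` (treated as) homogeneous of weight `k`:
`u*v = ∑_{i≥0} (k choose i) u_{i-1} v`. -/
noncomputable def VOA.mulAux (A : VOA V) (k : ℤ) (u v : V) : V :=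
  ∑ᶠ i : ℕ, zchoose k i • A.Y u ((i : ℤ) - 1) v

/-- Zhu's circle product `u ∘ v` for `u` (treated as) homogeneous of weight `k`:
`u∘v = ∑_{i≥0} (k choose i) u_{i-2} v`. -/
noncomputable def VOA.circAux (A : VOA V) (k : ℤ) (u v : V) : V :=
  ∑ᶠ i : ℕ, zchoose k i • A.Y u ((i : ℤ) - 2) v

/-- Zhu's product `u * v`, extended bilinearly via homogeneous components of `u`. -/
noncomputable def VOA.star (A : VOA V) (u v : V) : V :=
  ∑ᶠ k : ℤ, A.mulAux k (A.hcomp k u) v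

/-- The subspace `O(V)` spanned by all circle products `u ∘ v` with `u` homogeneous;
Zhu's algebra is `A(V) = V/O(V)` with product induced by `VOA.star`. -/
def VOA.Osub (A : VOA V) : Submodule ℂ V :=
  Submodule.span ℂ {w | ∃ (k : ℤ) (u v : V), u ∈ A.wt k ∧ w = A.circAux k u v}

/-- A weak module for a vertex operator algebra, given by modes satisfying
truncation, the vacuum axiom and the Borcherds identity. -/
structure WkMod (A : VOA V) (M : Type) [AddCommGroup M] [Module ℂ M] : Type where
  act : V →ₗ[ℂ] ℤ → Module.End ℂ M
  trunc : ∀ (u : V) (w : M), ∃ N : ℤ, ∀ n : ℤ, N ≤ n → act u n w = 0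
  vacuum_act : ∀ n : ℤ, act A.one n = if n = -1 then (1 : Module.End ℂ M) else 0
  borcherds : ∀ (u v : V) (w : M) (p m n : ℤ),
    ∑ᶠ i : ℕ, zchoose m i • act (A.Y u (p + i) v) (m + n - i) w
      = ∑ᶠ i : ℕ, ((-1 : ℂ) ^ i * zchoose p i) •
          (act u (m + p - i) (act v (n + i) w)
            - ((-1 : ℂ) ^ p) • act v (n + p - i) (act u (m + i) w))

/-- An admissible (`ℕ`-gradable) module for a vertex operator algebra:
a weak module with an `ℕ`-grading with nonzero top level, compatible with weights. -/
structure AdmMod (A : VOA V) (M : Type) [AddCommGroup M] [Module ℂ M]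
    extends WkMod A M : Type where
  gr : ℕ → Submodule ℂ M
  grInternal : DirectSum.IsInternal gr
  top_ne_bot : gr 0 ≠ ⊥
  gr_mode : ∀ (k : ℤ) (u : V), u ∈ A.wt k → ∀ (m : ℤ) (n : ℕ) (w : M), w ∈ gr n →
    act u m w ∈
      if 0 ≤ (n : ℤ) + k - m - 1 then gr ((n : ℤ) + k - m - 1).toNat else ⊥

/-- An ordinary module for a vertex operator algebra: a weak module on which `L(0)`
acts semisimply with finite dimensional eigenspaces whose weights are truncated from
below in each coset `λ + ℤ`. -/
structure OrdMod (A : VOA V) (M : Type) [AddCommGroup M] [Module ℂ M]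
    extends WkMod A M : Type where
  wtm : ℂ → Submodule ℂ M
  indep : iSupIndep wtm
  spans : ⨆ c : ℂ, wtm c = ⊤
  L0_diag : ∀ (c : ℂ) (w : M), w ∈ wtm c → act A.omega 1 w = c • w
  fdim : ∀ c : ℂ, FiniteDimensional ℂ (wtm c)
  bounded_below : ∀ c : ℂ, ∃ N : ℤ, ∀ m : ℤ, m < N → wtm (c + m) = ⊥

/-- Irreducibility of a weak module. -/
def WkMod.Irreducible {A : VOA V} {M : Type} [AddCommGroup M] [Module ℂ M]
    (P : WkMod A M) : Prop :=
  (∃ w : M, w ≠ 0) ∧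
    ∀ U : Submodule ℂ M, (∀ (u : V) (n : ℤ) (w : M), w ∈ U → P.act u n w ∈ U) →
      U = ⊥ ∨ U = ⊤

/-- Isomorphism of two weak modules over the same vertex operator algebra. -/
def ModIso (A : VOA V) {M N : Type} [AddCommGroup M] [Module ℂ M]
    [AddCommGroup N] [Module ℂ N] (P : WkMod A M) (Q : WkMod A N) : Prop :=
  ∃ f : M ≃ₗ[ℂ] N, ∀ (u : V) (n : ℤ) (w : M), f (P.act u n w) = Q.act u n (f w)

/-- The action of the zero-mode `o(u) = u_{wt u - 1}` (extended linearly from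
homogeneous vectors) on a weak module; it preserves the top level of an
admissible module. -/
noncomputable def WkMod.oAct {A : VOA V} {M : Type} [AddCommGroup M] [Module ℂ M]
    (Q : WkMod A M) (u : V) (w : M) : M :=
  ∑ᶠ k : ℤ, Q.act (A.hcomp k u) (k - 1) w

/-- Action of a word of creation operators `h_{a_1}(-n_1) ⋯ h_{a_k}(-n_k)`. -/
def wordAct {ℓ : ℕ} {M : Type} (f : Fin ℓ → ℤ → M → M) : List (Fin ℓ × ℕ+) → M → M
  | [], w => w
  | (a, n) :: L, w => f a (-((n : ℕ) : ℤ)) (wordAct f L w)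

/-- Action of a word of twisted creation operators
`h_{a_1}(-n_1+1/2) ⋯ h_{a_k}(-n_k+1/2)` (indices doubled). -/
def twWordAct {ℓ : ℕ} {M : Type} (f : Fin ℓ → ℤ → M → M) : List (Fin ℓ × ℕ+) → M → M
  | [], w => w
  | (a, n) :: L, w => f a (-(2 * ((n : ℕ) : ℤ) - 1)) (twWordAct f L w)

/-- `A` is the rank `ℓ` free bosonic (Heisenberg) vertex operator algebra
`𝓗 = M(1)`, with generators `hgen a = h_a(-1)𝟏` for an orthonormal basis
`h_1, …, h_ℓ` of `𝔥`: the generators have weight one, their modes satisfy the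
Heisenberg commutation relations `[h_a(m), h_b(n)] = m δ_{ab} δ_{m+n,0}`, the
conformal vector is `ω = (1/2) ∑_a h_a(-1)²𝟏`, and `V` is spanned by the vectors
`h_{a_1}(-n_1) ⋯ h_{a_k}(-n_k)𝟏`. -/
structure IsHeisenberg {ℓ : ℕ} (A : VOA V) (hgen : Fin ℓ → V) : Prop where
  wt_one : ∀ a, hgen a ∈ A.wt 1
  heis_comm : ∀ (a b : Fin ℓ) (m n : ℤ),
    A.Y (hgen a) m * A.Y (hgen b) n - A.Y (hgen b) n * A.Y (hgen a) m
      = (if a = b ∧ m + n = 0 then (m : ℂ) else 0) • (1 : Module.End ℂ V)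
  omega_eq : A.omega
      = (1 / 2 : ℂ) • ∑ a : Fin ℓ, A.Y (hgen a) (-1) (A.Y (hgen a) (-1) A.one)
  span_words : Submodule.span ℂ
      {v : V | ∃ L : List (Fin ℓ × ℕ+),
        v = wordAct (fun a k w => A.Y (hgen a) k w) L A.one} = ⊤

/-- `θ` is the automorphism of the free bosonic vertex operator algebra induced
by `-1` on `𝔥`. -/
structure IsThetaAut {ℓ : ℕ} (A : VOA V) (hgen : Fin ℓ → V) (θ : V ≃ₗ[ℂ] V) : Prop where
  map_one : θ A.one = A.one
  map_omega : θ A.omega = A.omega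
  map_Y : ∀ (u : V) (n : ℤ) (v : V), θ (A.Y u n v) = A.Y (θ u) n (θ v)
  map_gen : ∀ a, θ (hgen a) = -hgen a
  map_wt : ∀ (k : ℤ) (v : V), v ∈ A.wt k → θ v ∈ A.wt k

/-- `B` (with underlying space `W`, embedded in `V` by `ι`) is the fixed point
vertex operator subalgebra `V^θ` of the involution `θ`. -/
structure IsFixedSubVOA {W : Type} [AddCommGroup W] [Module ℂ W]
    (A : VOA V) (θ : V ≃ₗ[ℂ] V) (B : VOA W) (ι : W →ₗ[ℂ] V) : Prop where
  inj : Function.Injective ι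
  range_eq : LinearMap.range ι
      = Module.End.eigenspace (θ.toLinearMap : Module.End ℂ V) 1
  map_one : ι B.one = A.one
  map_omega : ι B.omega = A.omega
  map_Y : ∀ (u : W) (n : ℤ) (v : W), ι (B.Y u n v) = A.Y (ι u) n (ι v)
  map_wt : ∀ (k : ℤ) (w : W), w ∈ B.wt k ↔ ι w ∈ A.wt k

/-- `P` is (isomorphic to) the Fock module `M(1,λ)` over the rank `ℓ` Heisenberg
vertex operator algebra: it has a nonzero vector `v₀` with `h_a(n)v₀ = 0` for
`n ≥ 1`, `h_a(0)v₀ = λ_a v₀`, which generates `M` under the creation operators. -/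
def IsFockModule {ℓ : ℕ} {M : Type} [AddCommGroup M] [Module ℂ M]
    (A : VOA V) (hgen : Fin ℓ → V) (P : WkMod A M) (lam : Fin ℓ → ℂ) : Prop :=
  ∃ v0 : M, v0 ≠ 0 ∧ (∀ (a : Fin ℓ) (n : ℤ), 1 ≤ n → P.act (hgen a) n v0 = 0) ∧
    (∀ a : Fin ℓ, P.act (hgen a) 0 v0 = lam a • v0) ∧
    Submodule.span ℂ {w : M | ∃ L : List (Fin ℓ × ℕ+),
      w = wordAct (fun a k x => P.act (hgen a) k x) L v0} = ⊤

/-- A weak `θ`-twisted module (for an involution `θ`): the modes are indexed by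
`(1/2)ℤ`, encoded here by doubling (so `act u k` is the mode `u_{k/2}`); on the
eigenspace `θ = (-1)^r` only modes with `k ≡ r (mod 2)` act, and the component
form of the twisted Jacobi identity holds. -/
structure TwMod (A : VOA V) (θ : V ≃ₗ[ℂ] V) (M : Type) [AddCommGroup M]
    [Module ℂ M] : Type where
  act : V →ₗ[ℂ] ℤ → Module.End ℂ M
  trunc : ∀ (u : V) (w : M), ∃ N : ℤ, ∀ n : ℤ, N ≤ n → act u n w = 0
  vacuum_act : ∀ n : ℤ, act A.one n = if n = -2 then (1 : Module.End ℂ M) else 0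
  moding : ∀ (u : V) (r : ℤ), θ u = ((-1 : ℂ) ^ r) • u →
    ∀ k : ℤ, (k - r) % 2 ≠ 0 → act u k = 0
  borcherds : ∀ (u v : V) (r s : ℤ), θ u = ((-1 : ℂ) ^ r) • u →
    θ v = ((-1 : ℂ) ^ s) • v → ∀ (w : M) (p K N : ℤ),
    ∑ᶠ i : ℕ, ((qchoose ((K : ℚ) / 2) i : ℚ) : ℂ) • act (A.Y u (p + i) v) (K + N - 2 * i) w
      = ∑ᶠ i : ℕ, ((-1 : ℂ) ^ i * zchoose p i) •
          (act u (K + 2 * p - 2 * i) (act v (N + 2 * i) w)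
            - ((-1 : ℂ) ^ p) • act v (N + 2 * p - 2 * i) (act u (K + 2 * i) w))

/-- Irreducibility of a twisted module. -/
def TwMod.Irreducible {A : VOA V} {θ : V ≃ₗ[ℂ] V} {M : Type} [AddCommGroup M]
    [Module ℂ M] (T : TwMod A θ M) : Prop :=
  (∃ w : M, w ≠ 0) ∧
    ∀ U : Submodule ℂ M, (∀ (u : V) (k : ℤ) (w : M), w ∈ U → T.act u k w ∈ U) →
      U = ⊥ ∨ U = ⊤

/-- `T` is (isomorphic to) the canonical irreducible `θ`-twisted module
`𝓗(θ) = S(𝔥 ⊗ t^{-1/2}ℂ[t^{-1/2}])` of the rank `ℓ` free bosonic vertex operator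
algebra: it has a nonzero vector killed by all modes `h_a(k/2)`, `k ≥ 1`, which
generates it under the twisted creation operators. -/
def IsCanonicalTwMod {ℓ : ℕ} {M : Type} [AddCommGroup M] [Module ℂ M]
    (A : VOA V) (hgen : Fin ℓ → V) {θ : V ≃ₗ[ℂ] V} (T : TwMod A θ M) : Prop :=
  ∃ v0 : M, v0 ≠ 0 ∧ (∀ (a : Fin ℓ) (k : ℤ), 1 ≤ k → T.act (hgen a) k v0 = 0) ∧
    Submodule.span ℂ {w : M | ∃ L : List (Fin ℓ × ℕ+),
      w = twWordAct (fun a k x => T.act (hgen a) k x) L v0} = ⊤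

/-- `σ` is the canonical involution of the twisted module `𝓗(θ)` (acting by
`(-1)^k` on monomials of length `k`): it is an involution compatible with `θ`
through the twisted action and fixing the lowest weight vectors. -/
def TwInvolution {ℓ : ℕ} {M : Type} [AddCommGroup M] [Module ℂ M]
    (A : VOA V) (hgen : Fin ℓ → V) {θ : V ≃ₗ[ℂ] V} (T : TwMod A θ M)
    (σ : M ≃ₗ[ℂ] M) : Prop :=
  (∀ w : M, σ (σ w) = w) ∧
  (∀ (u : V) (k : ℤ) (w : M), σ (T.act u k w) = T.act (θ u) k (σ w)) ∧
  (∀ v0 : M, (∀ (a : Fin ℓ) (k : ℤ), 1 ≤ k → T.act (hgen a) k v0 = 0) → σ v0 = v0)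

/-- The weak `B = V^θ`-module `Q` "is" the eigenspace `V^{(ε)}` of `θ` on `V`
(e.g. `𝓗⁺` itself for `ε = 1` and `𝓗⁻` for `ε = -1`), with action obtained by
restricting the vertex operators of `V`. -/
def IsEigenPartModule {W N : Type} [AddCommGroup W] [Module ℂ W]
    [AddCommGroup N] [Module ℂ N] (A : VOA V) (θ : V ≃ₗ[ℂ] V) {B : VOA W}
    (ι : W →ₗ[ℂ] V) (ε : ℂ) (Q : WkMod B N) : Prop :=
  ∃ j : N →ₗ[ℂ] V, Function.Injective j ∧
    LinearMap.range j = Module.End.eigenspace (θ.toLinearMap : Module.End ℂ V) ε ∧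
    ∀ (u : W) (n : ℤ) (w : N), j (Q.act u n w) = A.Y (ι u) n (j w)

/-- The weak `B = V^θ`-module `Q` "is" the eigenspace `𝓗(θ)^{(ε)}` of the
involution `σ` on the twisted module `𝓗(θ)`, with the restricted twisted action
(`u ∈ V^θ` acts by its integral modes). -/
def IsTwEigenPartModule {W MT N : Type} [AddCommGroup W] [Module ℂ W]
    [AddCommGroup MT] [Module ℂ MT] [AddCommGroup N] [Module ℂ N]
    (A : VOA V) {θ : V ≃ₗ[ℂ] V} {B : VOA W} (ι : W →ₗ[ℂ] V)
    (T : TwMod A θ MT) (σ : MT ≃ₗ[ℂ] MT) (ε : ℂ) (Q : WkMod B N) : Prop :=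
  ∃ j : N →ₗ[ℂ] MT, Function.Injective j ∧
    LinearMap.range j = Module.End.eigenspace (σ.toLinearMap : Module.End ℂ MT) ε ∧
    ∀ (u : W) (n : ℤ) (w : N), j (Q.act u n w) = T.act (ι u) (2 * n) (j w)

/-- The weak `B = 𝓗⁺`-module `Q` "is" the restriction to `𝓗⁺` of the Fock module
`M(1,λ)`. -/
def IsFockRestriction {ℓ : ℕ} {W N : Type} [AddCommGroup W] [Module ℂ W]
    [AddCommGroup N] [Module ℂ N] (A : VOA V) (hgen : Fin ℓ → V) {B : VOA W}
    (ι : W →ₗ[ℂ] V) (lam : Fin ℓ → ℂ) (Q : WkMod B N) : Prop :=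
  ∃ P : WkMod A N, IsFockModule A hgen P lam ∧
    ∀ (u : W) (n : ℤ), Q.act u n = P.act (ι u) n

/-- A realization of Zhu's algebra `A(V) = V/O(V)` of a vertex operator algebra
as an abstract associative `ℂ`-algebra `R`. -/
structure ZhuRealization (A : VOA V) (R : Type) [Ring R] [Algebra ℂ R] : Type where
  π : V →ₗ[ℂ] R
  surj : Function.Surjective π
  ker_eq : LinearMap.ker π = A.Osub
  map_star : ∀ u v : V, π (A.star u v) = π u * π v
  map_one : π A.one = 1

/-- The `R = A(V)`-module `M` "is" the top level `N(0)` of the admissible module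
`N`, where `[u] ∈ A(V)` acts on the top level by the zero-mode `o(u)`. -/
def IsTopLevelOf {R : Type} [Ring R] [Algebra ℂ R] {A : VOA V}
    (Z : ZhuRealization A R) {N : Type} [AddCommGroup N] [Module ℂ N]
    (Qa : AdmMod A N) (M : Type) [AddCommGroup M] [Module R M] : Prop :=
  ∃ f : M →+ N, Function.Injective f ∧ (∀ m : M, f m ∈ Qa.gr 0) ∧
    (∀ w ∈ Qa.gr 0, ∃ m : M, f m = w) ∧
    ∀ (u : V) (m : M), f (Z.π u • m) = Qa.toWkMod.oAct u (f m)

/-- Iterated Zhu product of a list of elements (an empty product is `[𝟏]`). -/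
noncomputable def starList (A : VOA V) : List V → V
  | [] => A.one
  | x :: L => A.star x (starList A L)

/-- The linear span of all Zhu-monomials in a set of generators; modulo `O(V)`
this is the subalgebra of `A(V)` generated by the images of the generators. -/
def genMonomials (A : VOA V) (gens : Set V) : Submodule ℂ V :=
  Submodule.span ℂ {w : V | ∃ L : List V, (∀ g ∈ L, g ∈ gens) ∧ w = starList A L}

/-- The subspace `𝓦^α ⊆ 𝓗` spanned by the monomials
`h_{a_1}(-n_1) ⋯ h_{a_k}(-n_k)𝟏` whose number of letters from `𝓗_c` is odd
exactly for `c ∈ α`; thus `wordSpanV A hgen ∅ = 𝓦 = 𝓗₁⁺ ⊗ ⋯ ⊗ 𝓗_ℓ⁺`. -/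
def wordSpanV {ℓ : ℕ} (A : VOA V) (hgen : Fin ℓ → V) (α : Finset (Fin ℓ)) :
    Submodule ℂ V :=
  Submodule.span ℂ {v : V | ∃ L : List (Fin ℓ × ℕ+),
    (∀ c : Fin ℓ, c ∈ α ↔ ¬ Even ((L.map Prod.fst).count c)) ∧
    v = wordAct (fun a k w => A.Y (hgen a) k w) L A.one}

/-- The element `S_{ab}(m,n) = h_a(-m)h_b(-n)𝟏` of `𝓗`. -/
def SV {ℓ : ℕ} (A : VOA V) (hgen : Fin ℓ → V) (a b : Fin ℓ) (m n : ℤ) : V :=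
  A.Y (hgen a) (-m) (A.Y (hgen b) (-n) A.one)

/-- The element `ω_a = (1/2) h_a(-1)²𝟏` of `𝓗⁺`. -/
def omegaV {ℓ : ℕ} (A : VOA V) (hgen : Fin ℓ → V) (a : Fin ℓ) : V :=
  (1 / 2 : ℂ) • SV A hgen a a 1 1

/-- The element `J_a = h_a(-1)⁴𝟏 - 2h_a(-3)h_a(-1)𝟏 + (3/2)h_a(-2)²𝟏` of `𝓗⁺`. -/
def JV {ℓ : ℕ} (A : VOA V) (hgen : Fin ℓ → V) (a : Fin ℓ) : V :=
  A.Y (hgen a) (-1) (A.Y (hgen a) (-1) (A.Y (hgen a) (-1) (A.Y (hgen a) (-1) A.one)))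
    - (2 : ℂ) • SV A hgen a a 3 1 + (3 / 2 : ℂ) • SV A hgen a a 2 2

variable {W : Type} [AddCommGroup W] [Module ℂ W]

/-- `E^u_{ab}` (for `a ≠ b`), as a combination of the `S_{ab}(1,m)`. -/
def EuW {ℓ : ℕ} (s : Fin ℓ → Fin ℓ → ℤ → ℤ → W) (a b : Fin ℓ) : W :=
  (5 : ℂ) • s a b 1 2 + (25 : ℂ) • s a b 1 3 + (36 : ℂ) • s a b 1 4 + (16 : ℂ) • s a b 1 5

/-- `E^t_{ab}` (for `a ≠ b`), as a combination of the `S_{ab}(1,m)`. -/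
def EtW {ℓ : ℕ} (s : Fin ℓ → Fin ℓ → ℤ → ℤ → W) (a b : Fin ℓ) : W :=
  (-16 : ℂ) • ((3 : ℂ) • s a b 1 2 + (14 : ℂ) • s a b 1 3 + (19 : ℂ) • s a b 1 4
    + (8 : ℂ) • s a b 1 5)

/-- `Λ_{ab}` (for `a ≠ b`), as a combination of the `S_{ab}(1,m)`. -/
def LamW {ℓ : ℕ} (s : Fin ℓ → Fin ℓ → ℤ → ℤ → W) (a b : Fin ℓ) : W :=
  (45 : ℂ) • s a b 1 2 + (190 : ℂ) • s a b 1 3 + (240 : ℂ) • s a b 1 4 + (96 : ℂ) • s a b 1 5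

/-- The full setting of the paper: `A = 𝓗` is the rank `ℓ` free bosonic vertex
operator algebra with Heisenberg generators `hgen`, `θ` is its `-1` involution,
and `B = 𝓗⁺` is the fixed point vertex operator subalgebra, embedded by `ι`. -/
structure HeisenbergPlusSetting (ℓ : ℕ) (V W : Type) [AddCommGroup V] [Module ℂ V]
    [AddCommGroup W] [Module ℂ W] : Type where
  A : VOA V
  hgen : Fin ℓ → V
  heis : IsHeisenberg A hgen
  θ : V ≃ₗ[ℂ] V
  thetaAut : IsThetaAut A hgen θ
  B : VOA W
  ι : W →ₗ[ℂ] V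
  fixedSub : IsFixedSubVOA A θ B ι

/-- Bundled weak module over a vertex operator algebra. -/
structure ARep (A : VOA V) : Type 1 where
  carrier : Type
  [acg : AddCommGroup carrier]
  [mod : Module ℂ carrier]
  str : WkMod A carrier

attribute [instance] ARep.acg ARep.mod

/-- Bundled admissible module over a vertex operator algebra. -/
structure BRep (A : VOA V) : Type 1 where
  carrier : Type
  [acg : AddCommGroup carrier]
  [mod : Module ℂ carrier]
  adm : AdmMod A carrier

attribute [instance] BRep.acg BRep.mod

/-- Bundled twisted module over a vertex operator algebra with involution. -/
structure TwRep (A : VOA V) (θ : V ≃ₗ[ℂ] V) : Type 1 where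
  carrier : Type
  [acg : AddCommGroup carrier]
  [mod : Module ℂ carrier]
  str : TwMod A θ carrier

attribute [instance] TwRep.acg TwRep.mod

end

set_option linter.unusedSimpArgs false
set_option linter.unusedTactic false

namespace HeisCert

noncomputable section

/-- Polynomials: integer combinations of words; the letter `x` encodes the creation operator
of colour `x % N` and mode `-(x / N + 1)`. -/
abbrev Poly := List (ℤ × List ℕ)

/-- Binomial coefficients, read off from a power. -/
def chooseF (n k : ℕ) : ℕ :=
  Nat.mod (Nat.div (Nat.pow (Nat.succ (Nat.pow 2 (Nat.succ n))) n)
    (Nat.pow 2 (Nat.mul (Nat.succ n) k))) (Nat.pow 2 (Nat.succ n))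

def sgn (n : ℕ) : ℤ := bif Nat.beq (Nat.mod n 2) 0 then 1 else -1

/-- The weight of a letter. -/
def lw (N x : ℕ) : ℕ := Nat.succ (Nat.div x N)

def lmap {α β : Type} (f : α → β) (l : List α) : List β :=
  List.rec [] (fun x _ ih => f x :: ih) l

def lapp {α : Type} (l l' : List α) : List α :=
  List.rec l' (fun x _ ih => x :: ih) l

def lbind {α β : Type} (f : α → List β) (l : List α) : List β :=
  List.rec [] (fun x _ ih => lapp (f x) ih) l

def lrange (n : ℕ) : List ℕ := Nat.rec [] (fun i ih => i :: ih) n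

def lall {α : Type} (f : α → Bool) (l : List α) : Bool :=
  List.rec true (fun x _ ih => and (f x) ih) l

def wtW (N : ℕ) (w : List ℕ) : ℕ := List.rec 0 (fun x _ ih => Nat.add (lw N x) ih) w

def ins (x : ℕ) (w : List ℕ) : List ℕ :=
  List.rec [x] (fun y w ih => bif Nat.ble x y then x :: y :: w else y :: ih) w

def picks (w : List ℕ) : List (ℕ × List ℕ) :=
  List.rec [] (fun y w ih => (y, w) :: lmap (fun t => (t.1, y :: t.2)) ih) w

def disj (N : ℕ) (u w : List ℕ) : Bool :=
  lall (fun x => lall (fun y => not (Nat.beq (Nat.mod y N) (Nat.mod x N))) w) u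

def scale (c : ℤ) (p : Poly) : Poly := lmap (fun t => (Int.mul c t.1, t.2)) p

/-- The indices used in the creation part of a mode. -/
def idx (N x : ℕ) (u : List ℕ) (r : ℕ) (w : List ℕ) : List ℕ :=
  List.rec (bif Nat.ble (Nat.add (lw N x) (wtW N w)) r then
      [Nat.sub r (Nat.add (lw N x) (wtW N w))] else [])
    (fun _ _ _ => lrange (Nat.sub r (Nat.div x N))) u

/-- The component of weight `r` of `Y(u,z) w` for words `u`, `w`. -/
def modeW (N : ℕ) (u : List ℕ) : ℕ → List ℕ → Poly :=
  List.rec (fun r w => bif Nat.beq r (wtW N w) then [(1, w)] else [])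
    (fun x u ih r w =>
      bif and (disj N (x :: u) w) (Nat.blt r (Nat.add (wtW N (x :: u)) (wtW N w))) then [] else
      lapp (lbind (fun i : ℕ =>
        lmap (fun t => (Int.mul (Int.ofNat (chooseF (Nat.add (Nat.div x N) i) (Nat.div x N))) t.1,
            ins (Nat.add x (Nat.mul N i)) t.2))
          (ih (Nat.sub r (Nat.add (lw N x) i)) w)) (idx N x u r w))
      (lbind (fun t => bif Nat.beq (Nat.mod t.1 N) (Nat.mod x N) then
          scale (Int.mul (sgn (Nat.div x N)) (Int.ofNat (Nat.mul (lw N t.1)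
            (chooseF (Nat.add (Nat.div x N) (lw N t.1)) (Nat.div x N)))))
          (ih r t.2) else []) (picks w))) u

/-- `∑_{i ≤ wt u} (wt u choose i) u_{i-s-1} w`. -/
def prodW (N : ℕ) (s : ℕ) (u w : List ℕ) : Poly :=
  lbind (fun i : ℕ =>
    bif Nat.blt (Nat.add (Nat.add (wtW N u) (wtW N w)) s) i then [] else
    scale (Int.ofNat (chooseF (wtW N u) i))
      (modeW N u (Nat.sub (Nat.add (Nat.add (wtW N u) (wtW N w)) s) i) w))
  (lrange (Nat.succ (wtW N u)))

/-- Comparison of words. -/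
def cmpW (u : List ℕ) : List ℕ → Ordering :=
  List.rec (fun w => List.rec .eq (fun _ _ _ => .lt) w)
    (fun x _ ih w => List.rec .gt (fun y w _ =>
      bif Nat.beq x y then ih w else bif Nat.ble x y then .lt else .gt) w) u

def mergeAux (t : ℤ × List ℕ) (f : Poly → Poly) (p : Poly) : Poly :=
  List.rec (t :: f []) (fun s q ih =>
    Ordering.rec (t :: f (s :: q)) ((Int.add t.1 s.1, t.2) :: f q) (s :: ih) (cmpW t.2 s.2)) p

def merge (p : Poly) : Poly → Poly :=
  List.rec (fun q => q) (fun t _ ih => mergeAux t ih) p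

def mergePairs : List Poly → List Poly
  | p :: q :: l => merge p q :: mergePairs l
  | l => l

def mergeAll : ℕ → List Poly → Poly
  | 0, l => lbind (fun p => p) l
  | n + 1, l => mergeAll n (mergePairs l)

def isZ (c : ℤ) : Bool := Int.rec (fun n => Nat.beq n 0) (fun _ => false) c

def dropZero (p : Poly) : Poly :=
  List.rec [] (fun t _ ih => bif isZ t.1 then ih else t :: ih) p

/-- Collect equal words. -/
def normP (p : Poly) : Poly := dropZero (mergeAll 12 (lmap (fun t => [t]) p))

/-- Zhu's product of polynomials. -/
def starP (N : ℕ) (p q : Poly) : Poly :=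
  normP (lbind (fun t => lbind (fun r => scale (Int.mul t.1 r.1) (prodW N 0 t.2 r.2)) q) p)

def isZero (p : Poly) : Bool := (normP p).isEmpty

def evenW (u : List ℕ) : Bool := Nat.beq (Nat.mod u.length 2) 0

/-- A certificate: a list of triples `(c, u, v)` standing for `∑ c • (u ∘ v)`. -/
def certP (N : ℕ) (l : List (ℤ × List ℕ × List ℕ)) : Poly :=
  lbind (fun t => scale t.1 (prodW N 1 t.2.1 t.2.2)) l

def check (N : ℕ) (K : ℤ) (p : Poly) (l : List (ℤ × List ℕ × List ℕ)) : Bool :=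
  and (not (isZ K)) (and (lall (fun t => and (evenW t.2.1) (evenW t.2.2)) l)
    (isZero (lapp (scale K p) (certP N l))))

end

end HeisCert

namespace HeisCert

theorem lmap_eq {α β : Type} (f : α → β) (l : List α) : lmap f l = l.map f := by
  induction l with
  | nil => rfl
  | cons x l ih => exact congrArg (f x :: ·) ih

theorem lapp_eq {α : Type} (l l' : List α) : lapp l l' = l ++ l' := by
  induction l with
  | nil => rfl
  | cons x l ih => exact congrArg (x :: ·) ih

theorem lbind_eq {α β : Type} (f : α → List β) (l : List α) : lbind f l = l.flatMap f := by
  induction l with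
  | nil => rfl
  | cons x l ih =>
    have h : lbind f (x :: l) = lapp (f x) (lbind f l) := rfl
    rw [h, lapp_eq, ih, List.flatMap_cons]

theorem lrange_succ (n : ℕ) : lrange (n + 1) = n :: lrange n := rfl

theorem lrange_sum {V : Type} [AddCommGroup V] (f : ℕ → V) (n : ℕ) :
    ((lrange n).map f).sum = ∑ i ∈ Finset.range n, f i := by
  induction n with
  | zero => rfl
  | succ n ih => rw [lrange_succ, List.map_cons, List.sum_cons, ih, Finset.sum_range_succ, add_comm]

theorem lall_iff {α : Type} (f : α → Bool) (l : List α) : lall f l = true ↔ ∀ x ∈ l, f x = true := by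
  induction l with
  | nil => simp [lall]
  | cons x l ih =>
    have h : lall f (x :: l) = (f x && lall f l) := rfl
    rw [h, Bool.and_eq_true, ih]; simp

theorem wtW_nil (N : ℕ) : wtW N [] = 0 := rfl
theorem wtW_cons (N x : ℕ) (w : List ℕ) : wtW N (x :: w) = x / N + 1 + wtW N w := rfl
theorem lw_eq (N x : ℕ) : lw N x = x / N + 1 := rfl

theorem picks_cons (y : ℕ) (w : List ℕ) :
    picks (y :: w) = (y, w) :: (picks w).map (fun t => (t.1, y :: t.2)) := by
  rw [← lmap_eq]; rfl

theorem picks_wt (N : ℕ) (w : List ℕ) : ∀ t ∈ picks w, wtW N w = t.1 / N + 1 + wtW N t.2 := by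
  induction w with
  | nil => intro t ht; exact absurd ht (by simp [picks])
  | cons y w ih =>
    intro t ht
    rw [picks_cons, List.mem_cons, List.mem_map] at ht
    rcases ht with rfl | ⟨s, hs, rfl⟩
    · rfl
    · have := ih s hs
      simp only [wtW_cons]; omega

theorem picks_mem (w : List ℕ) : ∀ t ∈ picks w, t.1 ∈ w ∧ ∀ z ∈ t.2, z ∈ w := by
  induction w with
  | nil => intro t ht; exact absurd ht (by simp [picks])
  | cons y w ih =>
    intro t ht
    rw [picks_cons, List.mem_cons, List.mem_map] at ht
    rcases ht with rfl | ⟨s, hs, rfl⟩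
    · exact ⟨by simp, fun z hz => List.mem_cons_of_mem _ hz⟩
    · have := ih s hs
      refine ⟨by simp [this.1], ?_⟩
      intro z hz
      simp only [List.mem_cons] at hz ⊢
      rcases hz with h | h
      · exact Or.inl h
      · exact Or.inr (this.2 z h)

theorem disj_iff (N : ℕ) (u w : List ℕ) :
    disj N u w = true ↔ ∀ x ∈ u, ∀ y ∈ w, y % N ≠ x % N := by
  unfold disj
  rw [lall_iff]
  refine forall₂_congr fun x _ => ?_
  rw [lall_iff]
  refine forall₂_congr fun y _ => ?_
  change (!(Nat.beq (y % N) (x % N))) = true ↔ _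
  rw [Bool.not_eq_true', ← Bool.not_eq_true, Nat.beq_eq]

theorem chooseF_eq (n k : ℕ) : chooseF n k = n.choose k := by
  have h0 : chooseF n k = ((2 ^ (n + 1) + 1) ^ n / 2 ^ ((n + 1) * k)) % 2 ^ (n + 1) := rfl
  rw [h0, pow_mul]
  generalize hB : 2 ^ (n + 1) = B
  have hB1 : 1 < B := by rw [← hB]; exact Nat.one_lt_two_pow (by omega)
  have hlt : ∀ j, n.choose j < B := fun j => by
    rw [← hB]
    exact lt_of_le_of_lt (Nat.choose_le_two_pow n j) (Nat.pow_lt_pow_right (by norm_num) (by omega))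
  have key : ∀ m, (∑ j ∈ Finset.range m, n.choose j * B ^ j) < B ^ m := by
    intro m
    induction m with
    | zero => simp
    | succ m ih =>
      rw [Finset.sum_range_succ]
      have h1 : n.choose m + 1 ≤ B := hlt m
      calc _ < B ^ m + n.choose m * B ^ m := by omega
        _ = (n.choose m + 1) * B ^ m := by ring
        _ ≤ B * B ^ m := Nat.mul_le_mul_right _ h1
        _ = B ^ (m + 1) := by ring
  have hsum : (B + 1) ^ n = ∑ j ∈ Finset.range (n + 1), n.choose j * B ^ j := by
    rw [add_pow]; refine Finset.sum_congr rfl fun j _ => by simp [mul_comm]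
  have hext : ∀ M, n + 1 ≤ M → (B + 1) ^ n = ∑ j ∈ Finset.range M, n.choose j * B ^ j := by
    intro M hM
    rw [hsum]
    refine Finset.sum_subset (fun x hx => by simp at hx ⊢; omega) (fun x _ hx => ?_)
    simp only [Finset.mem_range, not_lt] at hx
    rw [Nat.choose_eq_zero_of_lt (by omega), zero_mul]
  have hsplit : ∀ M, ∃ q, ∑ j ∈ Finset.range (k + 1 + M), n.choose j * B ^ j
      = (∑ j ∈ Finset.range k, n.choose j * B ^ j) + B ^ k * (n.choose k + B * q) := by
    intro M
    induction M with
    | zero => exact ⟨0, by rw [add_zero, Finset.sum_range_succ]; ring⟩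
    | succ M ih =>
      obtain ⟨q, hq⟩ := ih
      refine ⟨q + n.choose (k + 1 + M) * B ^ M, ?_⟩
      rw [← add_assoc, Finset.sum_range_succ, hq]; ring
  obtain ⟨q, hq⟩ := hsplit (n + 1)
  rw [hext (k + 1 + (n + 1)) (by omega), hq, Nat.add_mul_div_left _ _ (by positivity),
    Nat.div_eq_of_lt (key k), zero_add, Nat.add_mul_mod_self_left, Nat.mod_eq_of_lt (hlt k)]

theorem sgn_eq (n : ℕ) : sgn n = (-1) ^ n := by
  have h : sgn n = bif Nat.beq (n % 2) 0 then 1 else -1 := rfl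
  rw [h]
  rcases Nat.even_or_odd n with he | ho
  · rw [Nat.even_iff.1 he, he.neg_one_pow]; rfl
  · rw [Nat.odd_iff.1 ho, ho.neg_one_pow]; rfl

theorem zchoose_nat (k i : ℕ) : zchoose (k : ℤ) i = (k.choose i : ℂ) := by
  have h : qchoose ((k : ℤ) : ℚ) i = (k.choose i : ℚ) := by
    induction i with
    | zero => simp [qchoose]
    | succ i ih =>
      rw [qchoose, ih, div_eq_iff (by positivity)]
      have := Nat.choose_succ_right_eq k i
      rcases le_or_gt i k with hik | hik
      · have h2 : ((k - i : ℕ) : ℚ) = (k : ℚ) - i := by push_cast [hik]; ring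
        have h3 : ((k.choose (i+1) * (i+1) : ℕ) : ℚ) = ((k.choose i * (k - i) : ℕ) : ℚ) := by rw [this]
        push_cast [hik] at h3
        push_cast
        linarith
      · rw [Nat.choose_eq_zero_of_lt hik, Nat.choose_eq_zero_of_lt (by omega)]; simp
  rw [zchoose, h]; simp

theorem zchoose_neg (m i : ℕ) :
    (-1 : ℂ) ^ i * zchoose (-(m : ℤ) - 1) i = ((m + i).choose m : ℂ) := by
  have h : (-1 : ℚ) ^ i * qchoose ((-(m : ℤ) - 1 : ℤ) : ℚ) i = ((m + i).choose m : ℚ) := by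
    induction i with
    | zero => simp [qchoose]
    | succ i ih =>
      have h1 := Nat.choose_mul_succ_eq (m + i) m
      rw [show m + i + 1 - m = i + 1 by omega] at h1
      have h3 : (((m+i).choose m * (m+i+1) : ℕ) : ℚ) = ((((m + i + 1).choose m) * (i + 1) : ℕ) : ℚ) := by
        rw [h1]
      push_cast at h3
      rw [qchoose, pow_succ, ← add_assoc]
      have : ((i : ℚ) + 1) ≠ 0 := by positivity
      have h4 : (-1 : ℚ) ^ i * -1 * (qchoose ((-(m : ℤ) - 1 : ℤ) : ℚ) i * (((-(m : ℤ) - 1 : ℤ) : ℚ) - i) / (i + 1))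
        = ((-1 : ℚ) ^ i * qchoose ((-(m : ℤ) - 1 : ℤ) : ℚ) i) * (m + i + 1) / (i + 1) := by
        push_cast; ring
      rw [h4, ih, div_eq_iff this, h3]
  rw [zchoose]
  have := congrArg (fun q : ℚ => (q : ℂ)) h
  push_cast at this ⊢
  exact this

theorem zchoose_zero_succ (i : ℕ) : zchoose 0 (i + 1) = 0 := by
  have := zchoose_nat 0 (i + 1)
  simpa using this
theorem zchoose_zero (k : ℤ) : zchoose k 0 = 1 := by simp [zchoose, qchoose]

end HeisCert

namespace HeisCert

section Sound

variable {V : Type} [AddCommGroup V] [Module ℂ V] {ℓ : ℕ} (A : VOA V) (hg : Fin ℓ → V) (N : ℕ)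
  (κ : ℕ → Fin ℓ)

/-- The vector of the Fock space attached to a word. -/
noncomputable def evW : List ℕ → V
  | [] => A.one
  | x :: w => A.Y (hg (κ (x % N))) (-((x / N : ℕ) : ℤ) - 1) (evW w)

/-- The vector of the Fock space attached to a polynomial. -/
noncomputable def ev (p : Poly) : V := (p.map fun t => (t.1 : ℂ) • evW A hg N κ t.2).sum

theorem ev_nil : ev A hg N κ [] = 0 := rfl

theorem ev_cons (t : ℤ × List ℕ) (p : Poly) :
    ev A hg N κ (t :: p) = (t.1 : ℂ) • evW A hg N κ t.2 + ev A hg N κ p := rfl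

theorem ev_append (p q : Poly) : ev A hg N κ (p ++ q) = ev A hg N κ p + ev A hg N κ q := by
  simp [ev]

theorem ev_lapp (p q : Poly) : ev A hg N κ (lapp p q) = ev A hg N κ p + ev A hg N κ q := by
  rw [lapp_eq, ev_append]

theorem ev_lbind {α : Type} (f : α → Poly) (l : List α) :
    ev A hg N κ (lbind f l) = (l.map fun x => ev A hg N κ (f x)).sum := by
  rw [lbind_eq]
  induction l with
  | nil => rfl
  | cons x l ih => rw [List.flatMap_cons, ev_append, ih, List.map_cons, List.sum_cons]

theorem ev_scale (c : ℤ) (p : Poly) : ev A hg N κ (scale c p) = (c : ℂ) • ev A hg N κ p := by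
  unfold scale
  rw [lmap_eq]
  induction p with
  | nil => simp [ev_nil]
  | cons t p ih =>
    rw [List.map_cons, ev_cons, ih, ev_cons, smul_add, smul_smul]
    congr 2
    exact Int.cast_mul c t.1

variable (hA : IsHeisenberg A hg)
include hA

theorem comm_apply (a b : Fin ℓ) (m n : ℤ) (v : V) :
    A.Y (hg a) m (A.Y (hg b) n v) = A.Y (hg b) n (A.Y (hg a) m v)
      + (if a = b ∧ m + n = 0 then (m : ℂ) else 0) • v := by
  have := congrArg (fun f : Module.End ℂ V => f v) (hA.heis_comm a b m n)
  simp only [LinearMap.sub_apply, Module.End.mul_apply, LinearMap.smul_apply, Module.End.one_apply] at this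
  rw [← this]; abel

theorem evW_ins (x : ℕ) (w : List ℕ) : evW A hg N κ (ins x w) = evW A hg N κ (x :: w) := by
  induction w with
  | nil => rfl
  | cons y w ih =>
    have h : ins x (y :: w) = bif Nat.ble x y then x :: y :: w else y :: ins x w := rfl
    rw [h]
    cases Nat.ble x y with
    | true => rfl
    | false =>
      simp only [cond_false]
      rw [evW, ih, evW, evW, evW, comm_apply A hg hA, if_neg ?_, zero_smul, add_zero]
      rintro ⟨-, h0⟩
      push_cast at h0
      have h1 : (0 : ℤ) ≤ (x : ℤ) / N := by positivity
      have h2 : (0 : ℤ) ≤ (y : ℤ) / N := by positivity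
      omega

theorem annih (a : Fin ℓ) (i : ℕ) (w : List ℕ) :
    A.Y (hg a) i (evW A hg N κ w) = ((picks w).map fun t =>
      if κ (t.1 % N) = a ∧ t.1 / N + 1 = i then (i : ℂ) • evW A hg N κ t.2 else 0).sum := by
  induction w with
  | nil => exact A.create_ge _ _ (by omega)
  | cons y w ih =>
    rw [picks_cons, List.map_cons, List.sum_cons, evW, comm_apply A hg hA, ih, map_list_sum,
      List.map_map, List.map_map, add_comm]
    congr 1
    · rw [ite_smul, zero_smul]
      refine if_congr ?_ (by push_cast; rfl) rfl
      refine and_congr eq_comm ?_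
      simp only
      omega
    · congr 1
      refine List.map_congr_left fun t _ => ?_
      simp only [Function.comp_apply]
      split_ifs
      · rw [map_smul]; rfl
      · rw [map_zero]

omit hA in
theorem borch (a : Fin ℓ) (m : ℕ) (v w : V) (k : ℤ) (M : ℕ)
    (h1 : ∀ i : ℕ, M ≤ i → A.Y v (k + i) w = 0)
    (h2 : ∀ i : ℕ, M ≤ i → A.Y (hg a) i w = 0) :
    A.Y (A.Y (hg a) (-(m : ℤ) - 1) v) k w = ∑ i ∈ Finset.range M, (((m + i).choose m : ℕ) : ℂ) •
      (A.Y (hg a) (-(m : ℤ) - 1 - i) (A.Y v (k + i) w)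
        + (-1 : ℂ) ^ m • A.Y v (k - m - 1 - i) (A.Y (hg a) i w)) := by
  have hb := A.borcherds (hg a) v w (-(m : ℤ) - 1) 0 k
  rw [finsum_eq_single _ 0] at hb
  · rw [zchoose_zero, one_smul] at hb
    simp only [Nat.cast_zero, add_zero, zero_add, sub_zero] at hb
    rw [hb]
    rw [finsum_eq_sum_of_support_subset (s := Finset.range M)]
    · refine Finset.sum_congr rfl fun i _ => ?_
      rw [zchoose_neg]
      congr 1
      rw [sub_eq_add_neg, ← neg_smul]
      congr 2
      · rw [zpow_sub₀ (by norm_num), zpow_neg, zpow_natCast, zpow_one, ← inv_pow]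
        simp [div_neg]
      · congr 2; ring
    · intro i hi
      simp only [Finset.coe_range, Set.mem_Iio]
      by_contra hlt
      push Not at hlt
      apply hi
      simp only
      rw [h1 i hlt, h2 i hlt]; simp
  · intro i hi
    obtain ⟨j, rfl⟩ := Nat.exists_eq_succ_of_ne_zero hi
    rw [zchoose_zero_succ, zero_smul]

theorem ann_zero (a : Fin ℓ) (i : ℕ) (w : List ℕ) (hi : wtW N w < i) :
    A.Y (hg a) i (evW A hg N κ w) = 0 := by
  rw [annih A hg N κ hA]
  apply List.sum_eq_zero
  intro x hx
  rw [List.mem_map] at hx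
  obtain ⟨t, ht, rfl⟩ := hx
  have := picks_wt N w t ht
  rw [if_neg (by omega)]

theorem vanish (u : List ℕ) : ∀ (w : List ℕ) (j : ℤ), (wtW N u : ℤ) + wtW N w ≤ j →
    A.Y (evW A hg N κ u) j (evW A hg N κ w) = 0 := by
  induction u with
  | nil =>
    intro w j hj
    rw [evW, A.vacuum_act, if_neg (by omega)]; rfl
  | cons x u ih =>
    intro w j hj
    rw [wtW_cons] at hj
    push_cast at hj
    have hp : (0 : ℤ) ≤ (x : ℤ) / N := by positivity
    rw [evW, borch A hg _ _ _ _ _ (wtW N w + 1)]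
    · refine Finset.sum_eq_zero fun i _ => ?_
      rw [ih w _ (by omega), map_zero, zero_add, annih A hg N κ hA, map_list_sum, List.sum_eq_zero,
        smul_zero, smul_zero]
      intro y hy
      rw [List.map_map, List.mem_map] at hy
      obtain ⟨t, ht, rfl⟩ := hy
      have := picks_wt N w t ht
      simp only [Function.comp_apply]
      split_ifs with hc
      · rw [map_smul, ih _ _ (by push_cast; omega), smul_zero]
      · rw [map_zero]
    · intro i _; exact ih w _ (by omega)
    · intro i hi; exact ann_zero A hg N κ hA _ _ _ (by omega)

/-- The recursion for modes of words. -/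
theorem mode_cons (x : ℕ) (u w : List ℕ) (k : ℤ) (M : ℕ) (hM : (wtW N u : ℤ) + wtW N w ≤ k + M) :
    A.Y (evW A hg N κ (x :: u)) k (evW A hg N κ w) =
      (∑ i ∈ Finset.range M, (((x / N + i).choose (x / N) : ℕ) : ℂ) •
        A.Y (hg (κ (x % N))) (-((x / N : ℕ) : ℤ) - 1 - i)
          (A.Y (evW A hg N κ u) (k + i) (evW A hg N κ w))) +
      ((picks w).map fun t => if κ (t.1 % N) = κ (x % N) then
        ((-1 : ℂ) ^ (x / N) * ((t.1 / N + 1 : ℕ) *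
          (((x / N + (t.1 / N + 1)).choose (x / N) : ℕ) : ℂ))) •
        A.Y (evW A hg N κ u) (k - (x / N : ℕ) - 1 - (t.1 / N + 1 : ℕ)) (evW A hg N κ t.2)
        else 0).sum := by
  have hext : ∀ M', M ≤ M' → (∑ i ∈ Finset.range M', (((x / N + i).choose (x / N) : ℕ) : ℂ) •
        A.Y (hg (κ (x % N))) (-((x / N : ℕ) : ℤ) - 1 - i)
          (A.Y (evW A hg N κ u) (k + i) (evW A hg N κ w))) =
      (∑ i ∈ Finset.range M, (((x / N + i).choose (x / N) : ℕ) : ℂ) •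
        A.Y (hg (κ (x % N))) (-((x / N : ℕ) : ℤ) - 1 - i)
          (A.Y (evW A hg N κ u) (k + i) (evW A hg N κ w))) := by
    intro M' h
    symm
    refine Finset.sum_subset (fun y hy => by simp at hy ⊢; omega) (fun y _ hy => ?_)
    simp only [Finset.mem_range, not_lt] at hy
    rw [vanish A hg N κ hA _ _ _ (by omega), map_zero, smul_zero]
  rw [evW, borch A hg _ _ _ _ _ (M + wtW N w + 1)]
  · simp only [smul_add]
    rw [Finset.sum_add_distrib, hext _ (by omega)]
    congr 1
    have hstep : ∀ i : ℕ, (((x / N + i).choose (x / N) : ℕ) : ℂ) • (-1 : ℂ) ^ (x / N) •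
        A.Y (evW A hg N κ u) (k - (x / N : ℕ) - 1 - i) (A.Y (hg (κ (x % N))) i (evW A hg N κ w))
        = ((picks w).map fun t => if t.1 / N + 1 = i then
          if κ (t.1 % N) = κ (x % N) then
        ((-1 : ℂ) ^ (x / N) * ((t.1 / N + 1 : ℕ) *
          (((x / N + (t.1 / N + 1)).choose (x / N) : ℕ) : ℂ))) •
        A.Y (evW A hg N κ u) (k - (x / N : ℕ) - 1 - (t.1 / N + 1 : ℕ)) (evW A hg N κ t.2)
        else 0 else 0).sum := by
      intro i
      rw [annih A hg N κ hA, map_list_sum, List.map_map, List.smul_sum, List.smul_sum, List.map_map,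
        List.map_map]
      congr 1
      refine List.map_congr_left fun t _ => ?_
      simp only [Function.comp_apply]
      by_cases hi : t.1 / N + 1 = i
      · subst hi
        by_cases hc : κ (t.1 % N) = κ (x % N)
        · simp only [hc, and_self, if_true, map_smul, smul_smul]
          congr 1; ring
        · simp [hc]
      · simp [hi]
    rw [Finset.sum_congr rfl fun i _ => hstep i]
    have hsw : ∀ (l : List (ℕ × List ℕ)) (f : ℕ × List ℕ → V) (M : ℕ),
        (∀ t ∈ l, t.1 / N + 1 < M) →
        ∑ i ∈ Finset.range M, (l.map fun t => if t.1 / N + 1 = i then f t else 0).sum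
          = (l.map f).sum := by
      intro l f M hl
      induction l with
      | nil => simp
      | cons t l ih =>
        simp only [List.map_cons, List.sum_cons]
        rw [Finset.sum_add_distrib, ih fun s hs => hl s (List.mem_cons_of_mem _ hs),
          Finset.sum_ite_eq, if_pos (Finset.mem_range.2 (hl t (by simp)))]
    rw [hsw]
    intro t ht
    have := picks_wt N w t ht
    omega
  · intro i hi; exact vanish A hg N κ hA _ _ _ (by omega)
  · intro i hi; exact ann_zero A hg N κ hA _ _ _ (by omega)

variable (hN : 0 < N) (hκ : ∀ i j, i < N → j < N → κ i = κ j → i = j)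
include hN hκ

theorem disj_vanish (u w : List ℕ) (hd : ∀ x ∈ u, ∀ y ∈ w, y % N ≠ x % N) :
    ∀ (k : ℤ), 0 ≤ k → A.Y (evW A hg N κ u) k (evW A hg N κ w) = 0 := by
  induction u with
  | nil => intro k hk; rw [evW, A.vacuum_act, if_neg (by omega)]; rfl
  | cons x u ih =>
    intro k hk
    have ih' := ih fun x hx => hd x (List.mem_cons_of_mem _ hx)
    rw [mode_cons A hg N κ hA x u w k (wtW N u + wtW N w) (by push_cast; omega), List.sum_eq_zero,
      add_zero]
    · refine Finset.sum_eq_zero fun i _ => ?_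
      rw [ih' _ (by omega), map_zero, smul_zero]
    · intro y hy
      rw [List.mem_map] at hy
      obtain ⟨t, ht, rfl⟩ := hy
      rw [if_neg]
      intro hc
      exact hd x (by simp) t.1 (picks_mem w t ht).1 (hκ _ _ (Nat.mod_lt _ hN) (Nat.mod_lt _ hN) hc)

theorem ev_modeW (u : List ℕ) : ∀ (r : ℕ) (w : List ℕ), ev A hg N κ (modeW N u r w) =
    A.Y (evW A hg N κ u) ((wtW N u : ℤ) + wtW N w - r - 1) (evW A hg N κ w) := by
  induction u with
  | nil =>
    intro r w
    have h : modeW N [] r w = bif Nat.beq r (wtW N w) then [(1, w)] else [] := rfl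
    rw [h, evW, A.vacuum_act, wtW_nil]
    by_cases hr : r = wtW N w
    · rw [(Nat.beq_eq ▸ hr : Nat.beq r (wtW N w) = true), if_pos (by omega)]
      simp [ev]
    · have hb : Nat.beq r (wtW N w) = false := by
        rw [← Bool.not_eq_true, Nat.beq_eq]; exact hr
      rw [hb, if_neg (by omega)]
      rfl
  | cons x u ih =>
    intro r w
    have h : modeW N (x :: u) r w =
      bif and (disj N (x :: u) w) (Nat.blt r (wtW N (x :: u) + wtW N w)) then [] else
      lapp (lbind (fun i : ℕ =>
        lmap (fun t => (Int.ofNat (chooseF (x / N + i) (x / N)) * t.1, ins (x + N * i) t.2))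
          (modeW N u (r - (lw N x + i)) w)) (idx N x u r w))
      (lbind (fun t => bif Nat.beq (t.1 % N) (x % N) then
          scale (sgn (x / N) * Int.ofNat (lw N t.1 * chooseF (x / N + lw N t.1) (x / N)))
          (modeW N u r t.2) else []) (picks w)) := rfl
    rw [h]
    cases hb : and (disj N (x :: u) w) (Nat.blt r (wtW N (x :: u) + wtW N w)) with
    | true =>
      rw [Bool.and_eq_true, disj_iff] at hb
      have h2 : r < wtW N (x :: u) + wtW N w := by
        have := hb.2; simpa [Nat.blt] using this
      rw [disj_vanish A hg N κ hA hN hκ _ _ hb.1 _ (by omega)]; rfl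
    | false =>
      rw [cond_false, ev_lapp, ev_lbind, ev_lbind,
        mode_cons A hg N κ hA x u w _ (r - x / N) (by rw [wtW_cons]; push_cast; omega)]
      congr 1
      · have hterm : ∀ i < r - x / N, ev A hg N κ (lmap (fun t =>
              (Int.ofNat (chooseF (x / N + i) (x / N)) * t.1, ins (x + N * i) t.2))
            (modeW N u (r - (lw N x + i)) w)) = (((x / N + i).choose (x / N) : ℕ) : ℂ) •
            A.Y (hg (κ (x % N))) (-((x / N : ℕ) : ℤ) - 1 - i) (A.Y (evW A hg N κ u)
            ((wtW N (x :: u) : ℤ) + wtW N w - r - 1 + i) (evW A hg N κ w)) := by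
          intro i hi
          have e : ((wtW N (x :: u) : ℤ) + wtW N w - r - 1 + i)
            = (wtW N u : ℤ) + wtW N w - (r - (lw N x + i) : ℕ) - 1 := by
            rw [wtW_cons, lw_eq]; push_cast [show x / N + 1 + i ≤ r by omega]; ring
          rw [e, ← ih, chooseF_eq, lmap_eq]
          generalize modeW N u (r - (lw N x + i)) w = p
          induction p with
          | nil => simp [ev_nil]
          | cons t p ihp =>
            rw [List.map_cons, ev_cons, ihp, ev_cons, map_add, smul_add]
            congr 1
            rw [evW_ins A hg N κ hA, evW, map_smul, smul_smul, Nat.add_mul_mod_self_left,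
              Nat.add_mul_div_left _ _ hN]
            congr 1
            · simp
            · congr 2; push_cast; ring
        cases u with
        | cons y u =>
          have : idx N x (y :: u) r w = lrange (r - x / N) := rfl
          rw [this, lrange_sum]
          exact Finset.sum_congr rfl fun i hi => hterm i (Finset.mem_range.1 hi)
        | nil =>
          have : idx N x [] r w = bif Nat.ble (lw N x + wtW N w) r then
            [r - (lw N x + wtW N w)] else [] := rfl
          rw [this]
          cases hble : Nat.ble (lw N x + wtW N w) r with
          | true =>
            rw [Nat.ble_eq, lw_eq] at hble
            rw [cond_true, List.map_cons, List.map_nil, List.sum_cons, List.sum_nil, add_zero,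
              hterm _ (by rw [lw_eq]; omega)]
            symm
            apply Finset.sum_eq_single (f := fun i : ℕ => _)
            · intro i hi hne
              rw [evW, A.vacuum_act, if_neg]
              · simp
              · rw [wtW_cons, wtW_nil]; rw [lw_eq] at hne; push_cast; push_cast at hne; omega
            · intro hn; exfalso; apply hn; rw [Finset.mem_range, lw_eq]; omega
          | false =>
            rw [← Bool.not_eq_true, Nat.ble_eq, lw_eq] at hble
            symm
            apply Finset.sum_eq_zero
            intro i hi
            rw [Finset.mem_range] at hi
            rw [evW, A.vacuum_act, if_neg]
            · simp
            · rw [wtW_cons, wtW_nil]; push_cast; push_cast at hble; omega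
      · congr 1
        refine List.map_congr_left fun t ht => ?_
        by_cases hc : t.1 % N = x % N
        · rw [(Nat.beq_eq ▸ hc : Nat.beq (t.1 % N) (x % N) = true), if_pos (by rw [hc]), cond_true, ev_scale, ih, sgn_eq, chooseF_eq, lw_eq]
          congr 1
          · rw [Int.ofNat_eq_natCast, Int.cast_mul, Int.cast_natCast, Nat.cast_mul]
            simp only [Int.cast_pow, Int.cast_neg, Int.cast_one]
          · congr 2
            rw [wtW_cons, picks_wt N w t ht]; push_cast; ring
        · have hb : Nat.beq (t.1 % N) (x % N) = false := by
            rw [← Bool.not_eq_true, Nat.beq_eq]; exact hc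
          rw [hb, if_neg fun h => hc (hκ _ _ (Nat.mod_lt _ hN) (Nat.mod_lt _ hN) h)]
          rfl

end Sound

end HeisCert

namespace HeisCert

section Sound

variable {V : Type} [AddCommGroup V] [Module ℂ V] {ℓ : ℕ} (A : VOA V) (hg : Fin ℓ → V) (N : ℕ)
  (κ : ℕ → Fin ℓ)

theorem cmpW_eq (u : List ℕ) : ∀ w, cmpW u w = .eq → u = w := by
  induction u with
  | nil =>
    intro w h
    cases w with
    | nil => rfl
    | cons y w => exact absurd h (by simp [cmpW])
  | cons x u ih =>
    intro w h
    cases w with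
    | nil => exact absurd h (by simp [cmpW])
    | cons y w =>
      have e : cmpW (x :: u) (y :: w) =
        bif Nat.beq x y then cmpW u w else bif Nat.ble x y then .lt else .gt := rfl
      rw [e] at h
      cases hb : Nat.beq x y with
      | true =>
        rw [hb, cond_true] at h
        rw [Nat.beq_eq] at hb
        rw [hb, ih w h]
      | false =>
        rw [hb, cond_false] at h
        cases hc : Nat.ble x y <;> rw [hc] at h <;> simp at h

theorem ev_mergeAux (t : ℤ × List ℕ) (f : Poly → Poly) (P : V)
    (hf : ∀ q, ev A hg N κ (f q) = P + ev A hg N κ q) (q : Poly) :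
    ev A hg N κ (mergeAux t f q) = (t.1 : ℂ) • evW A hg N κ t.2 + P + ev A hg N κ q := by
  induction q with
  | nil =>
    have h : mergeAux t f [] = t :: f [] := rfl
    rw [h, ev_cons, hf, add_assoc]
  | cons s q ih =>
    have h : mergeAux t f (s :: q) = Ordering.rec (t :: f (s :: q))
      ((t.1 + s.1, t.2) :: f q) (s :: mergeAux t f q) (cmpW t.2 s.2) := rfl
    rw [h]
    cases hc : cmpW t.2 s.2 with
    | lt => change ev A hg N κ (t :: f (s :: q)) = _; rw [ev_cons, hf, add_assoc]
    | eq =>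
      change ev A hg N κ ((t.1 + s.1, t.2) :: f q) = _
      rw [ev_cons, hf, ev_cons, ← cmpW_eq _ _ hc]
      push_cast
      module
    | gt => change ev A hg N κ (s :: mergeAux t f q) = _; rw [ev_cons, ih, ev_cons]; abel

theorem ev_merge (p : Poly) : ∀ q, ev A hg N κ (merge p q) = ev A hg N κ p + ev A hg N κ q := by
  induction p with
  | nil => intro q; rw [ev_nil, zero_add]; rfl
  | cons t p ih =>
    intro q
    have h : merge (t :: p) = mergeAux t (merge p) := rfl
    rw [h, ev_mergeAux A hg N κ t (merge p) (ev A hg N κ p) ih, ev_cons]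

theorem ev_mergePairs (l : List Poly) :
    ((mergePairs l).map (ev A hg N κ)).sum = (l.map (ev A hg N κ)).sum := by
  induction l using mergePairs.induct with
  | case1 p q l ih =>
    rw [mergePairs, List.map_cons, List.sum_cons, ih, ev_merge]
    simp [add_assoc]
  | case2 l h => rw [mergePairs]; exact h

theorem ev_mergeAll (n : ℕ) : ∀ l : List Poly,
    ev A hg N κ (mergeAll n l) = (l.map (ev A hg N κ)).sum := by
  induction n with
  | zero => intro l; rw [mergeAll, ev_lbind]
  | succ n ih => intro l; rw [mergeAll, ih, ev_mergePairs]

theorem isZ_iff (c : ℤ) : isZ c = true ↔ c = 0 := by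
  cases c with
  | ofNat n =>
    have : isZ (Int.ofNat n) = Nat.beq n 0 := rfl
    rw [this, Nat.beq_eq]; simp
  | negSucc n =>
    have : isZ (Int.negSucc n) = false := rfl
    rw [this]; simp

theorem ev_dropZero (p : Poly) : ev A hg N κ (dropZero p) = ev A hg N κ p := by
  induction p with
  | nil => rfl
  | cons t p ih =>
    have h : dropZero (t :: p) = bif isZ t.1 then dropZero p else t :: dropZero p := rfl
    rw [h]
    cases hz : isZ t.1 with
    | true => rw [cond_true, ih, ev_cons, (isZ_iff _).1 hz]; simp
    | false => rw [cond_false, ev_cons, ev_cons, ih]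

theorem ev_normP (p : Poly) : ev A hg N κ (normP p) = ev A hg N κ p := by
  rw [normP, ev_dropZero, ev_mergeAll, lmap_eq, List.map_map, ev]
  congr 1
  refine List.map_congr_left fun t _ => ?_
  simp [ev]

theorem ev_isZero (p : Poly) (h : isZero p = true) : ev A hg N κ p = 0 := by
  rw [isZero, List.isEmpty_iff] at h
  rw [← ev_normP, h, ev_nil]

theorem supp_fin (k : ℤ) (s : ℤ) (u v : V) :
    (Function.support fun i : ℕ => zchoose k i • A.Y u ((i : ℤ) - s) v).Finite := by
  obtain ⟨M, hM⟩ := A.trunc u v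
  refine (Set.finite_Iio (M + s).toNat).subset fun i hi => ?_
  by_contra hlt
  simp only [Set.mem_Iio, not_lt] at hlt
  apply hi
  simp only
  rw [hM _ (by omega), smul_zero]

theorem mulAux_add_left (k : ℤ) (u u' v : V) :
    A.mulAux k (u + u') v = A.mulAux k u v + A.mulAux k u' v := by
  unfold VOA.mulAux
  rw [← finsum_add_distrib (supp_fin A k 1 u v) (supp_fin A k 1 u' v)]
  refine finsum_congr fun i => ?_
  rw [map_add, Pi.add_apply, LinearMap.add_apply, smul_add]

theorem mulAux_smul_left (k : ℤ) (c : ℂ) (u v : V) :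
    A.mulAux k (c • u) v = c • A.mulAux k u v := by
  unfold VOA.mulAux
  rw [smul_finsum]
  refine finsum_congr fun i => ?_
  rw [map_smul, Pi.smul_apply, LinearMap.smul_apply, smul_comm]

theorem mulAux_add_right (k : ℤ) (u v v' : V) :
    A.mulAux k u (v + v') = A.mulAux k u v + A.mulAux k u v' := by
  unfold VOA.mulAux
  rw [← finsum_add_distrib (supp_fin A k 1 u v) (supp_fin A k 1 u v')]
  refine finsum_congr fun i => ?_
  rw [map_add, smul_add]

theorem mulAux_smul_right (k : ℤ) (c : ℂ) (u v : V) :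
    A.mulAux k u (c • v) = c • A.mulAux k u v := by
  unfold VOA.mulAux
  rw [smul_finsum]
  refine finsum_congr fun i => ?_
  rw [map_smul, smul_comm]

theorem mulAux_zero_left (k : ℤ) (v : V) : A.mulAux k 0 v = 0 := by
  have := mulAux_smul_left A k 0 0 v
  rwa [zero_smul, zero_smul] at this

theorem hcomp_add (k : ℤ) (u v : V) : A.hcomp k (u + v) = A.hcomp k u + A.hcomp k v := by
  simp [VOA.hcomp]

theorem hcomp_smul (k : ℤ) (c : ℂ) (u : V) : A.hcomp k (c • u) = c • A.hcomp k u := by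
  simp only [VOA.hcomp, map_smul]; rfl

theorem decompose_of (k : ℤ) (u : V) (hu : u ∈ A.wt k) :
    A.decompose u = DirectSum.lof ℂ ℤ (fun n => A.wt n) k ⟨u, hu⟩ := by
  unfold VOA.decompose
  rw [LinearEquiv.symm_apply_eq]
  change u = DirectSum.coeLinearMap A.wt _
  rw [DirectSum.coeLinearMap_lof]

theorem hcomp_self (k : ℤ) (u : V) (hu : u ∈ A.wt k) : A.hcomp k u = u := by
  rw [VOA.hcomp, decompose_of A k u hu, DirectSum.lof_apply]

theorem hcomp_ne (k j : ℤ) (u : V) (hu : u ∈ A.wt k) (h : j ≠ k) : A.hcomp j u = 0 := by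
  rw [VOA.hcomp, decompose_of A k u hu, DirectSum.lof_eq_of, DirectSum.of_eq_of_ne _ _ _ h]
  rfl

theorem hcomp_mem (k : ℤ) (u : V) : A.hcomp k u ∈ A.wt k := Subtype.property _

theorem hcomp_supp (u : V) : (Function.support fun k : ℤ => A.hcomp k u).Finite := by
  classical
  refine (DFinsupp.support (A.decompose u)).finite_toSet.subset fun k hk => ?_
  simp only [Finset.mem_coe, DFinsupp.mem_support_toFun]
  intro h
  apply hk
  change ((A.decompose u k : A.wt k) : V) = 0
  have : A.decompose u k = 0 := h
  rw [this]; rfl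

theorem sum_hcomp (u : V) : ∑ᶠ k : ℤ, A.hcomp k u = u := by
  classical
  have h : DirectSum.coeLinearMap A.wt (A.decompose u) = u :=
    (LinearEquiv.ofBijective (DirectSum.coeLinearMap A.wt) A.internal).apply_symm_apply u
  conv_rhs => rw [← h]
  rw [DirectSum.coeLinearMap_eq_dfinsuppSum, DFinsupp.sum]
  refine finsum_eq_sum_of_support_subset _ fun k hk => ?_
  simp only [Finset.mem_coe, DFinsupp.mem_support_toFun]
  intro h0
  apply hk
  change ((A.decompose u k : A.wt k) : V) = 0
  have : A.decompose u k = 0 := h0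
  rw [this]; rfl

theorem star_supp (u v : V) :
    (Function.support fun k : ℤ => A.mulAux k (A.hcomp k u) v).Finite := by
  refine (hcomp_supp A u).subset fun k hk => ?_
  intro h
  apply hk
  simp only at h ⊢
  rw [h, mulAux_zero_left]

/-- Zhu's product as a bilinear map. -/
noncomputable def starL : V →ₗ[ℂ] V →ₗ[ℂ] V :=
  LinearMap.mk₂ ℂ A.star
    (by
      intro u u' v
      unfold VOA.star
      rw [← finsum_add_distrib (star_supp A u v) (star_supp A u' v)]
      exact finsum_congr fun k => by rw [hcomp_add, mulAux_add_left])
    (by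
      intro c u v
      unfold VOA.star
      rw [smul_finsum]
      exact finsum_congr fun k => by rw [hcomp_smul, mulAux_smul_left])
    (by
      intro u v v'
      unfold VOA.star
      rw [← finsum_add_distrib (star_supp A u v) (star_supp A u v')]
      exact finsum_congr fun k => by rw [mulAux_add_right])
    (by
      intro c u v
      unfold VOA.star
      rw [smul_finsum]
      exact finsum_congr fun k => by rw [mulAux_smul_right])

theorem starL_apply (u v : V) : starL A u v = A.star u v := rfl

theorem star_hom (k : ℤ) (u v : V) (hu : u ∈ A.wt k) : A.star u v = A.mulAux k u v := by
  unfold VOA.star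
  rw [finsum_eq_single _ k, hcomp_self A k u hu]
  intro j hj
  rw [hcomp_ne A k j u hu hj, mulAux_zero_left]

variable (hA : IsHeisenberg A hg)
include hA

theorem evW_wt (w : List ℕ) : evW A hg N κ w ∈ A.wt (wtW N w) := by
  induction w with
  | nil => exact A.one_wt
  | cons x w ih =>
    have := A.mode_wt 1 _ (hA.wt_one (κ (x % N))) _ (-((x / N : ℕ) : ℤ) - 1) _ ih
    rw [evW, wtW_cons]
    convert this using 2
    push_cast; ring

variable (hN : 0 < N) (hκ : ∀ i j, i < N → j < N → κ i = κ j → i = j)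
include hN hκ

theorem ev_prodW (s : ℕ) (u w : List ℕ) : ev A hg N κ (prodW N s u w) =
    ∑ᶠ i : ℕ, zchoose (wtW N u) i •
      A.Y (evW A hg N κ u) ((i : ℤ) - (s + 1)) (evW A hg N κ w) := by
  rw [finsum_eq_sum_of_support_subset (s := Finset.range (wtW N u + 1))]
  · have h : prodW N s u w = lbind (fun i : ℕ =>
      bif Nat.blt (wtW N u + wtW N w + s) i then [] else
      scale (Int.ofNat (chooseF (wtW N u) i))
        (modeW N u (wtW N u + wtW N w + s - i) w)) (lrange (wtW N u + 1)) := rfl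
    rw [h, ev_lbind, lrange_sum]
    refine Finset.sum_congr rfl fun i hi => ?_
    rw [Finset.mem_range] at hi
    have hb : Nat.blt (wtW N u + wtW N w + s) i = false := by
      rw [← Bool.not_eq_true, Nat.blt, Nat.ble_eq]; omega
    rw [hb, cond_false, ev_scale, ev_modeW A hg N κ hA hN hκ, chooseF_eq, zchoose_nat]
    congr 1
    congr 2
    push_cast [show i ≤ wtW N u + wtW N w + s by omega]
    ring
  · intro i hi
    simp only [Finset.coe_range, Set.mem_Iio]
    by_contra hlt
    apply hi
    simp only
    rw [zchoose_nat, Nat.choose_eq_zero_of_lt (by omega)]; simp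

theorem ev_prodW_star (u w : List ℕ) : ev A hg N κ (prodW N 0 u w) =
    starL A (evW A hg N κ u) (evW A hg N κ w) := by
  rw [ev_prodW A hg N κ hA hN hκ, starL_apply, star_hom A _ _ _ (evW_wt A hg N κ hA u)]
  simp [VOA.mulAux]

theorem ev_prodW_circ (u w : List ℕ) : ev A hg N κ (prodW N 1 u w) =
    A.circAux (wtW N u) (evW A hg N κ u) (evW A hg N κ w) := by
  rw [ev_prodW A hg N κ hA hN hκ]
  simp only [VOA.circAux]
  norm_num

theorem ev_starP (p q : Poly) : ev A hg N κ (starP N p q) =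
    starL A (ev A hg N κ p) (ev A hg N κ q) := by
  rw [starP, ev_normP, ev_lbind]
  induction p with
  | nil => simp [ev_nil]
  | cons t p ih =>
    rw [List.map_cons, List.sum_cons, ih, ev_cons, map_add, LinearMap.add_apply, map_smul,
      LinearMap.smul_apply, ev_lbind]
    congr 1
    clear ih
    induction q with
    | nil => simp [ev_nil]
    | cons r q ih =>
      rw [List.map_cons, List.sum_cons, ih, ev_cons, map_add, smul_add, map_smul, ev_scale,
        ev_prodW_star A hg N κ hA hN hκ, smul_smul]
      congr 2
      exact Int.cast_mul _ _

end Sound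

section Fixed

variable {V : Type} [AddCommGroup V] [Module ℂ V] {W : Type} [AddCommGroup W] [Module ℂ W]
  {ℓ : ℕ} (S : HeisenbergPlusSetting ℓ V W) (N : ℕ) (κ : ℕ → Fin ℓ)

theorem iota_hcomp (k : ℤ) (x : W) : S.ι (S.B.hcomp k x) = S.A.hcomp k (S.ι x) := by
  have h : S.ι x = ∑ᶠ j : ℤ, S.ι (S.B.hcomp j x) := by
    conv_lhs => rw [← sum_hcomp S.B x]
    exact map_finsum S.ι (hcomp_supp S.B x)
  let f : V →+ V := ⟨⟨S.A.hcomp k, by have := hcomp_smul S.A k 0 0; simpa using this⟩,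
    hcomp_add S.A k⟩
  have hf : S.A.hcomp k (S.ι x) = ∑ᶠ j : ℤ, S.A.hcomp k (S.ι (S.B.hcomp j x)) := by
    rw [h]
    refine map_finsum f ((hcomp_supp S.B x).subset fun j hj h0 => hj ?_)
    simp only at h0 ⊢
    rw [h0, map_zero]
  have hw : ∀ j, S.ι (S.B.hcomp j x) ∈ S.A.wt j := fun j =>
    (S.fixedSub.map_wt j _).1 (hcomp_mem S.B j x)
  rw [hf, finsum_eq_single _ k, hcomp_self S.A k _ (hw k)]
  intro j hj
  exact hcomp_ne S.A j k _ (hw j) hj.symm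

theorem iota_mulAux (k : ℤ) (x y : W) :
    S.ι (S.B.mulAux k x y) = S.A.mulAux k (S.ι x) (S.ι y) := by
  unfold VOA.mulAux
  rw [map_finsum S.ι (supp_fin S.B k 1 x y)]
  exact finsum_congr fun i => by rw [map_smul, S.fixedSub.map_Y]

theorem iota_circAux (k : ℤ) (x y : W) :
    S.ι (S.B.circAux k x y) = S.A.circAux k (S.ι x) (S.ι y) := by
  unfold VOA.circAux
  rw [map_finsum S.ι (supp_fin S.B k 2 x y)]
  exact finsum_congr fun i => by rw [map_smul, S.fixedSub.map_Y]

theorem iota_star (x y : W) : S.ι (S.B.star x y) = starL S.A (S.ι x) (S.ι y) := by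
  rw [starL_apply]
  unfold VOA.star
  rw [map_finsum S.ι (star_supp S.B x y)]
  exact finsum_congr fun k => by rw [iota_mulAux, iota_hcomp]

theorem theta_evW (w : List ℕ) :
    S.θ (evW S.A S.hgen N κ w) = (-1 : ℂ) ^ w.length • evW S.A S.hgen N κ w := by
  induction w with
  | nil => simp [evW, S.thetaAut.map_one]
  | cons x w ih =>
    rw [evW, S.thetaAut.map_Y, ih, S.thetaAut.map_gen, List.length_cons, pow_succ, map_neg,
      Pi.neg_apply, LinearMap.neg_apply, map_smul]
    module

theorem even_range (w : List ℕ) (hw : evenW w = true) : ∃ x : W, S.ι x = evW S.A S.hgen N κ w := by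
  have he : Even w.length := by
    have h : evenW w = Nat.beq (w.length % 2) 0 := rfl
    rw [h, Nat.beq_eq] at hw
    exact Nat.even_iff.2 hw
  have : evW S.A S.hgen N κ w ∈ LinearMap.range S.ι := by
    rw [S.fixedSub.range_eq, Module.End.mem_eigenspace_iff]
    have := theta_evW S N κ w
    rw [he.neg_one_pow] at this
    exact this
  exact this

theorem check_sound (hN : 0 < N) (hκ : ∀ i j, i < N → j < N → κ i = κ j → i = j)
    (K : ℤ) (p : Poly) (l : List (ℤ × List ℕ × List ℕ)) (h : check N K p l = true)
    (x : W) (D : ℂ) (hD : D ≠ 0) (hx : D • S.ι x = ev S.A S.hgen N κ p) : x ∈ S.B.Osub := by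
  have h' : (!(isZ K) && (lall (fun t => evenW t.2.1 && evenW t.2.2) l &&
    isZero (lapp (scale K p) (certP N l)))) = true := h
  rw [Bool.and_eq_true, Bool.and_eq_true, lall_iff, Bool.not_eq_true', ← Bool.not_eq_true,
    isZ_iff] at h'
  obtain ⟨hK, hev, hz⟩ := h'
  have hc : ∃ y ∈ S.B.Osub, S.ι y = ev S.A S.hgen N κ (certP N l) := by
    clear hz hx h
    unfold certP
    rw [ev_lbind]
    induction l with
    | nil => exact ⟨0, zero_mem _, by simp⟩
    | cons t l ih =>
      obtain ⟨y, hy, hy'⟩ := ih fun s hs => hev s (List.mem_cons_of_mem _ hs)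
      have ht := hev t (by simp)
      rw [Bool.and_eq_true] at ht
      obtain ⟨u, hu⟩ := even_range S N κ _ ht.1
      obtain ⟨v, hv⟩ := even_range S N κ _ ht.2
      refine ⟨(t.1 : ℂ) • S.B.circAux (wtW N t.2.1) u v + y,
        add_mem (Submodule.smul_mem _ _ (Submodule.subset_span ⟨_, u, v, ?_, rfl⟩)) hy, ?_⟩
      · rw [S.fixedSub.map_wt, hu]; exact evW_wt S.A S.hgen N κ S.heis _
      · rw [List.map_cons, List.sum_cons, map_add, hy', map_smul, iota_circAux, hu, hv, ev_scale,
          ev_prodW_circ S.A S.hgen N κ S.heis hN hκ]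
  obtain ⟨y, hy, hy'⟩ := hc
  have h0 := ev_isZero S.A S.hgen N κ _ hz
  rw [ev_lapp, ev_scale, ← hx, ← hy', smul_smul, ← map_smul, ← map_add] at h0
  have h1 := S.fixedSub.inj (h0.trans (map_zero S.ι).symm)
  have hKD : (K : ℂ) * D ≠ 0 := mul_ne_zero (by exact_mod_cast hK) hD
  have h2 : ((K : ℂ) * D) • x ∈ S.B.Osub := by
    rw [eq_neg_of_add_eq_zero_left h1]; exact neg_mem hy
  exact (Submodule.smul_mem_iff _ hKD).1 h2

end Fixed

end HeisCert

namespace HeisCert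

/-- `S_{cd}(m+1,n+1)`. -/
noncomputable def sP (N c d m n : ℕ) : Poly := [(1, ins (c + N * m) [d + N * n])]

noncomputable def oneP : Poly := [(1, [])]

/-- twice `ω_c` -/
noncomputable def omP (N c : ℕ) : Poly := sP N c c 0 0

/-- twice `J_c` -/
noncomputable def jP (N c : ℕ) : Poly :=
  [(2, [c, c, c, c])] ++ (scale (-4) (sP N c c 2 0) ++ scale 3 (sP N c c 1 1))

/-- twice `H_c` -/
noncomputable def hP (N c : ℕ) : Poly :=
  jP N c ++ (omP N c ++ scale (-2) (starP N (omP N c) (omP N c)))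

noncomputable def combP (N c d : ℕ) (x y z t : ℤ) : Poly :=
  scale x (sP N c d 0 1) ++ (scale y (sP N c d 0 2) ++
    (scale z (sP N c d 0 3) ++ scale t (sP N c d 0 4)))

noncomputable def euP (c d : ℕ) : Poly := combP 2 c d 5 25 36 16
noncomputable def etP (c d : ℕ) : Poly := combP 2 c d (-48) (-224) (-304) (-128)
noncomputable def laP (N c d : ℕ) : Poly := combP N c d 45 190 240 96

noncomputable def t1P : Poly := starP 2 (scale 70 (hP 2 0) ++ (scale 594 (starP 2 (omP 2 0) (omP 2 0)) ++
  (scale (-585) (omP 2 0) ++ scale 54 oneP))) (hP 2 0)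

noncomputable def t2P : Poly := starP 2 (omP 2 0 ++ scale (-2) oneP)
  (starP 2 (scale 8 (omP 2 0) ++ scale (-1) oneP)
    (starP 2 (scale 8 (omP 2 0) ++ scale (-9) oneP) (hP 2 0)))

noncomputable def euaa : Poly := starP 2 (euP 0 1) (euP 1 0)
noncomputable def eubb : Poly := starP 2 (euP 1 0) (euP 0 1)
noncomputable def etaa : Poly := starP 2 (etP 0 1) (etP 1 0)
noncomputable def etbb : Poly := starP 2 (etP 1 0) (etP 0 1)

noncomputable def t3P : Poly := scale (-4) (hP 2 0) ++ (scale 4 (hP 2 1) ++ (scale (-72) euaa ++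
  (scale 72 eubb ++ (scale (-9) etaa ++ scale 9 etbb))))

noncomputable def t4P : Poly := scale (-64) (starP 2 (omP 2 0 ++ scale 13 oneP) (hP 2 0)) ++
  (scale 64 (starP 2 (omP 2 1 ++ scale 13 oneP) (hP 2 1)) ++
  (scale (-17280) euaa ++ (scale 17280 eubb ++ (scale (-2025) etaa ++ scale 2025 etbb))))

noncomputable def t5P : Poly := scale 15 (starP 2 (omP 2 1) (hP 2 0)) ++
  (scale 2 (starP 2 (omP 2 0 ++ scale (-2) oneP) (hP 2 0)) ++
    scale (-1) (starP 2 (omP 2 1 ++ scale (-2) oneP) (hP 2 1)))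

noncomputable def t6P : Poly := scale 36 (starP 2 (laP 2 0 1) (laP 2 0 1)) ++
  (scale (-36) (starP 2 (omP 2 0) (omP 2 1)) ++ (scale 2 (hP 2 0) ++ (scale 2 (hP 2 1) ++
  (scale 36 euaa ++ (scale 36 eubb ++ (scale 9 etaa ++ scale 9 etbb))))))

noncomputable def t7P : Poly := starP 3 (laP 3 0 1) (laP 3 1 2) ++
  scale (-1) (starP 3 (omP 3 1) (laP 3 0 2))

end HeisCert

namespace HeisCert

noncomputable def cert1 : List (ℤ × List ℕ × List ℕ) := [
  (1485540, [0, 0], []), (20851400, [0, 2], []), (8975325, [0, 0, 0, 0], []),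
  (52395140, [0, 4], []), (15835270, [2, 2], []), (2700420, [0, 0], [0, 2]),
  (27193140, [0, 0, 0, 2], []), (81723276, [0, 6], []), (35433756, [2, 4], []),
  (-9029340, [0, 0], [0, 4]), (41580, [0, 0, 0, 0, 0, 0], []), (21830040, [0, 0, 0, 4], []),
  (11596140, [0, 0, 2, 2], []), (71874576, [0, 8], []), (8123886, [2, 6], []),
  (17956548, [4, 4], []), (-588060, [0, 0], [0, 0, 0, 2]), (-8287110, [0, 0], [0, 6]),
  (-502200, [0, 0], [2, 4]), (213840, [0, 0, 0, 0, 0, 2], []), (4437180, [0, 0, 0, 6], []),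
  (10817280, [0, 0, 2, 4], []), (-1748520, [0, 2, 2, 2], []), (24666120, [0, 10], []),
  (-2856600, [2, 8], []), (8946180, [4, 6], [])]

theorem check1 : check 2 60 t1P cert1 = true := by decide +kernel

noncomputable def cert2 : List (ℤ × List ℕ × List ℕ) := [
  (2096220, [0, 0], []), (38177720, [0, 2], []), (3558135, [0, 0, 0, 0], []),
  (733779830, [0, 4], []), (340127095, [2, 2], []), (-577597230, [0, 0], [0, 2]),
  (257138112, [0, 0, 0, 2], []), (1115572038, [0, 6], []), (350499870, [2, 4], []),
  (-151081560, [0, 0], [0, 4]), (650720, [0, 0, 0, 0, 0, 0], []), (8019536, [0, 0, 0, 4], []),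
  (79521624, [0, 0, 2, 2], []), (722436848, [0, 8], []), (-31177258, [2, 6], []),
  (50552950, [4, 4], []), (19041120, [0, 0], [0, 0, 0, 2]), (146171130, [0, 0], [0, 6]),
  (129136560, [0, 0], [2, 4]), (-3064320, [0, 0, 0, 0, 0, 2], []), (11386116, [0, 0, 0, 6], []),
  (-2739072, [0, 0, 2, 4], []), (-17690064, [0, 2, 2, 2], []), (912197360, [0, 10], []),
  (-112054792, [2, 8], []), (70452008, [4, 6], []), (-7002240, [0, 0], [0, 0, 0, 4]),
  (90609624, [0, 0], [0, 8]), (23520, [0, 0, 0, 0, 0, 0, 0, 0], []),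
  (5994240, [0, 0, 0, 0, 0, 4], []), (-483840, [0, 0, 0, 0, 2, 2], []),
  (39467736, [0, 0, 0, 8], []), (-10559304, [0, 0, 2, 6], []), (39680928, [0, 0, 4, 4], []),
  (-8980944, [0, 2, 2, 4], []), (995172840, [0, 12], []), (1888698, [2, 2, 2, 2], []),
  (-82135560, [2, 10], []), (64254432, [4, 8], []), (92843172, [6, 6], []),
  (-604800, [0, 0], [0, 0, 0, 0, 0, 2]), (-7439040, [0, 0], [0, 0, 0, 6]),
  (-6289920, [0, 0], [0, 0, 2, 4]), (18823140, [0, 0], [0, 10]), (8061480, [0, 0], [2, 8]),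
  (-33807690, [0, 0], [4, 6]), (161280, [0, 0, 0, 0, 0, 0, 0, 2], []),
  (2056320, [0, 0, 0, 0, 0, 6], []), (2903040, [0, 0, 0, 0, 2, 4], []),
  (19595520, [0, 0, 0, 10], []), (-14835240, [0, 0, 2, 8], []), (30158100, [0, 0, 4, 6], []),
  (2903040, [0, 2, 2, 6], []), (5160960, [0, 2, 4, 4], []), (-17860500, [0, 4], [0, 6]),
  (389634840, [0, 14], []), (-967680, [2, 2, 2, 4], []), (-76025880, [2, 12], []),
  (96223680, [4, 10], []), (9356760, [6, 8], [])]

theorem check2 : check 2 420 t2P cert2 = true := by decide +kernel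

noncomputable def cert3 : List (ℤ × List ℕ × List ℕ) := [
  (-70, [0, 0], []), (70, [1, 1], []), (-74580, [0, 2], []), (74580, [1, 3], []),
  (-9006000, [0, 0], [1, 1]), (4503000, [0, 0, 1, 1], []), (-3617190, [0, 4], []),
  (-78690, [2, 2], []), (3617190, [1, 5], []), (78690, [3, 3], []), (-8103000, [0, 0], [1, 3]),
  (1755600, [0, 0, 1, 3], []), (1485600, [0, 1, 1, 2], []), (-48756318, [0, 6], []),
  (-789000, [0, 1], [0, 3]), (789000, [0, 1], [1, 2]), (1423638, [2, 4], []),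
  (48756318, [1, 7], []), (-1423638, [3, 5], []), (1970400, [0, 0], [1, 5]),
  (-1326600, [0, 0], [3, 3]), (-1242000, [0, 0, 1, 5], []), (281100, [0, 0, 3, 3], []),
  (1620600, [0, 1, 2, 3], []), (1046000, [0, 1, 1, 4], []), (-254821428, [0, 8], []),
  (-379100, [1, 1, 2, 2], []), (8843454, [2, 6], []), (1940974, [4, 4], []),
  (-4623600, [1, 1], [0, 4]), (254821428, [1, 9], []), (-8843454, [3, 7], []),
  (-1940974, [5, 5], []), (2047800, [0, 0], [1, 7]), (588000, [0, 0], [3, 5]),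
  (-168000, [0, 0, 1, 7], []), (-151200, [0, 0, 3, 5], []), (-805200, [0, 1, 2, 5], []),
  (67200, [0, 2, 3, 3], []), (693200, [0, 1, 3, 4], []), (84000, [0, 1, 1, 6], []),
  (-689736780, [0, 10], []), (403200, [0, 1], [0, 7]), (469200, [0, 1], [2, 5]),
  (-469200, [0, 1], [3, 4]), (-403200, [0, 1], [1, 6]), (-123200, [1, 2, 2, 3], []),
  (67200, [1, 1, 2, 4], []), (32540076, [2, 8], []), (4072704, [4, 6], []),
  (-1459800, [1, 1], [0, 6]), (689736780, [1, 11], []), (-32540076, [3, 9], []),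
  (-4072704, [5, 7], []), (-470400, [0, 0], [1, 9]), (310800, [0, 0], [3, 7]),
  (84000, [0, 0], [5, 5]), (201600, [0, 0, 1, 9], []), (-50400, [0, 0, 3, 7], []),
  (16800, [0, 0, 5, 5], []), (-218400, [0, 1, 2, 7], []), (-100800, [0, 2, 3, 5], []),
  (-705600, [0, 4], [1, 5]), (380800, [0, 1, 4, 5], []), (-44800, [0, 3, 3, 4], []),
  (134400, [0, 1, 3, 6], []), (-201600, [0, 1, 1, 8], []), (-1061069760, [0, 12], []),
  (72800, [1, 2, 2, 5], []), (7000, [2, 2, 3, 3], []), (16800, [1, 2, 3, 4], []),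
  (50400, [1, 1, 2, 6], []), (66613680, [2, 10], []), (-16800, [1, 1, 4, 4], []),
  (-3266496, [4, 8], []), (4816656, [6, 6], []), (638400, [1, 1], [0, 8]),
  (-142800, [1, 1], [2, 6]), (1061069760, [1, 13], []), (-66613680, [3, 11], []),
  (3266496, [5, 9], []), (-4816656, [7, 7], []), (-504000, [0, 0], [1, 11]),
  (201600, [0, 1, 2, 9], []), (-100800, [0, 1, 4, 7], []), (100800, [0, 1, 5, 6], []),
  (-201600, [0, 1, 3, 8], []), (-936831840, [0, 14], []), (-201600, [0, 1], [2, 9]),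
  (100800, [0, 1], [4, 7]), (-100800, [0, 1], [5, 6]), (201600, [0, 1], [3, 8]),
  (73881120, [2, 12], []), (-9803040, [4, 10], []), (6312480, [6, 8], []),
  (504000, [1, 1], [0, 10]), (936831840, [1, 15], []), (-73881120, [3, 13], []),
  (9803040, [5, 11], []), (-6312480, [7, 9], []), (-442982400, [0, 16], []),
  (42067200, [2, 14], []), (-8217600, [4, 12], []), (3840000, [6, 10], []), (168960, [8, 8], []),
  (442982400, [1, 17], []), (-42067200, [3, 15], []), (8217600, [5, 13], []),
  (-3840000, [7, 11], []), (-168960, [9, 9], []), (-87091200, [0, 18], []),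
  (9676800, [2, 16], []), (-2419200, [4, 14], []), (1036800, [6, 12], []),
  (87091200, [1, 19], []), (-9676800, [3, 17], []), (2419200, [5, 15], []),
  (-1036800, [7, 13], [])]

theorem check3 : check 2 5 t3P cert3 = true := by decide +kernel

noncomputable def cert4 : List (ℤ × List ℕ × List ℕ) := [
  (-11424, [0, 0], []), (11424, [1, 1], []), (-10124224, [0, 2], []), (10124224, [1, 3], []),
  (-1231709760, [0, 0], [1, 1]), (-336, [0, 0, 0, 0], []), (615854880, [0, 0, 1, 1], []),
  (-490768048, [0, 4], []), (-10839320, [2, 2], []), (336, [1, 1, 1, 1], []),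
  (490768048, [1, 5], []), (10839320, [3, 3], []), (2016, [0, 0], [0, 2]),
  (-1108360800, [0, 0], [1, 3]), (-1152, [0, 0, 0, 2], []), (240166080, [0, 0, 1, 3], []),
  (203178240, [0, 1, 1, 2], []), (-6622319664, [0, 6], []), (-107909280, [0, 1], [0, 3]),
  (107909280, [0, 1], [1, 2]), (193362192, [2, 4], []), (-2016, [1, 1], [1, 3]),
  (1152, [1, 1, 1, 3], []), (6622319664, [1, 7], []), (-193362192, [3, 5], []),
  (269395200, [0, 0], [1, 5]), (-181452960, [0, 0], [3, 3]), (-169853760, [0, 0, 1, 5], []),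
  (38441520, [0, 0, 3, 3], []), (221672160, [0, 1, 2, 3], []), (143040960, [0, 1, 1, 4], []),
  (-34622897472, [0, 8], []), (-51847920, [1, 1, 2, 2], []), (1201274064, [2, 6], []),
  (264334608, [4, 4], []), (-632301120, [1, 1], [0, 4]), (34622897472, [1, 9], []),
  (-1201274064, [3, 7], []), (-264334608, [5, 5], []), (280061280, [0, 0], [1, 7]),
  (80438400, [0, 0], [3, 5]), (-22982400, [0, 0, 1, 7], []), (-20684160, [0, 0, 3, 5], []),
  (-110099520, [0, 1, 2, 5], []), (9192960, [0, 2, 3, 3], []), (94777920, [0, 1, 3, 4], []),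
  (11491200, [0, 1, 1, 6], []), (-93736992960, [0, 10], []), (55157760, [0, 1], [0, 7]),
  (64134720, [0, 1], [2, 5]), (-64134720, [0, 1], [3, 4]), (-55157760, [0, 1], [1, 6]),
  (-16853760, [1, 2, 2, 3], []), (9192960, [1, 1, 2, 4], []), (4421219328, [2, 8], []),
  (554591232, [4, 6], []), (-199622880, [1, 1], [0, 6]), (93736992960, [1, 11], []),
  (-4421219328, [3, 9], []), (-554591232, [5, 7], []), (-64350720, [0, 0], [1, 9]),
  (42517440, [0, 0], [3, 7]), (11491200, [0, 0], [5, 5]), (27578880, [0, 0, 1, 9], []),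
  (-6894720, [0, 0, 3, 7], []), (2298240, [0, 0, 5, 5], []), (-29877120, [0, 1, 2, 7], []),
  (-13789440, [0, 2, 3, 5], []), (-96526080, [0, 4], [1, 5]), (52093440, [0, 1, 4, 5], []),
  (-6128640, [0, 3, 3, 4], []), (18385920, [0, 1, 3, 6], []), (-27578880, [0, 1, 1, 8], []),
  (-144231528960, [0, 12], []), (9959040, [1, 2, 2, 5], []), (957600, [2, 2, 3, 3], []),
  (2298240, [1, 2, 3, 4], []), (6894720, [1, 1, 2, 6], []), (9053579520, [2, 10], []),
  (-2298240, [1, 1, 4, 4], []), (-443639808, [4, 8], []), (655177248, [6, 6], []),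
  (87333120, [1, 1], [0, 8]), (-19535040, [1, 1], [2, 6]), (144231528960, [1, 13], []),
  (-9053579520, [3, 11], []), (443639808, [5, 9], []), (-655177248, [7, 7], []),
  (-68947200, [0, 0], [1, 11]), (27578880, [0, 1, 2, 9], []), (-13789440, [0, 1, 4, 7], []),
  (13789440, [0, 1, 5, 6], []), (-27578880, [0, 1, 3, 8], []), (-127367493120, [0, 14], []),
  (-27578880, [0, 1], [2, 9]), (13789440, [0, 1], [4, 7]), (-13789440, [0, 1], [5, 6]),
  (27578880, [0, 1], [3, 8]), (10043688960, [2, 12], []), (-1332564480, [4, 10], []),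
  (858435840, [6, 8], []), (68947200, [1, 1], [0, 10]), (127367493120, [1, 15], []),
  (-10043688960, [3, 13], []), (1332564480, [5, 11], []), (-858435840, [7, 9], []),
  (-60236144640, [0, 16], []), (5719956480, [2, 14], []), (-1117255680, [4, 12], []),
  (521994240, [6, 10], []), (23113728, [8, 8], []), (60236144640, [1, 17], []),
  (-5719956480, [3, 15], []), (1117255680, [5, 13], []), (-521994240, [7, 11], []),
  (-23113728, [9, 9], []), (-11844403200, [0, 18], []), (1316044800, [2, 16], []),
  (-329011200, [4, 14], []), (141004800, [6, 12], []), (11844403200, [1, 19], []),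
  (-1316044800, [3, 17], []), (329011200, [5, 15], []), (-141004800, [7, 13], [])]

theorem check4 : check 2 3 t4P cert4 = true := by decide +kernel

noncomputable def cert5 : List (ℤ × List ℕ × List ℕ) := [
  (168, [0, 0], []), (-84, [1, 1], []), (848, [0, 2], []), (-424, [1, 3], []),
  (90, [0, 0], [1, 1]), (42, [0, 0, 0, 0], []), (270, [0, 0, 1, 1], []), (1196, [0, 4], []),
  (595, [2, 2], []), (-21, [1, 1, 1, 1], []), (212, [1, 5], []), (-95, [3, 3], []),
  (-252, [0, 0], [0, 2]), (-270, [0, 0], [1, 3]), (144, [0, 0, 0, 2], []),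
  (1080, [0, 1, 1, 2], []), (684, [0, 6], []), (-1620, [0, 1], [1, 2]), (288, [2, 4], []),
  (126, [1, 1], [1, 3]), (-72, [1, 1, 1, 3], []), (468, [1, 7], []), (-144, [3, 5], [])]

theorem check5 : check 2 12 t5P cert5 = true := by decide +kernel

noncomputable def cert6 : List (ℤ × List ℕ × List ℕ) := [
  (980, [0, 0], []), (980, [1, 1], []), (-8830920, [0, 2], []), (-2026920, [1, 3], []),
  (-35809921140, [0, 0], [1, 1]), (17904961830, [0, 0, 1, 1], []), (331146270, [0, 4], []),
  (-303187815, [2, 2], []), (-713078730, [1, 5], []), (353492685, [3, 3], []),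
  (-41024389140, [0, 0], [1, 3]), (9828969108, [0, 0, 1, 3], []), (6677524308, [0, 1, 1, 2], []),
  (-3544018002, [0, 6], []), (-1452995460, [0, 1], [0, 3]), (1211148540, [0, 1], [1, 2]),
  (-333154962, [2, 4], []), (-1918202202, [1, 7], []), (326190438, [3, 5], []),
  (9088429980, [0, 0], [1, 5]), (-6410134920, [0, 0], [3, 3]), (-6305799696, [0, 0, 1, 5], []),
  (739015032, [0, 0, 3, 3], []), (8211930048, [0, 1, 2, 3], []), (4510346624, [0, 1, 1, 4], []),
  (-21885359832, [0, 8], []), (-1314778808, [1, 1, 2, 2], []), (1421767158, [2, 6], []),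
  (-56744226, [4, 4], []), (-20208564180, [1, 1], [0, 4]), (-6463967832, [1, 9], []),
  (-462575442, [3, 7], []), (161584374, [5, 5], []), (39506427660, [0, 0], [1, 7]),
  (5707359840, [0, 0], [3, 5]), (-9346298136, [0, 0, 1, 7], []), (-1164452016, [0, 0, 3, 5], []),
  (-2669788632, [0, 1, 2, 5], []), (447187104, [0, 2, 3, 3], []), (2042042408, [0, 1, 3, 4], []),
  (2831415384, [0, 1, 1, 6], []), (-52274635560, [0, 10], []), (2664315360, [0, 1], [0, 7]),
  (-1664477640, [0, 1], [2, 5]), (324961560, [0, 1], [3, 4]), (-478376640, [0, 1], [1, 6]),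
  (-797481776, [1, 2, 2, 3], []), (106966944, [1, 1, 2, 4], []), (3698487840, [2, 8], []),
  (-614462880, [4, 6], []), (-16197097140, [1, 1], [0, 6]), (-18018561960, [1, 11], []),
  (618522240, [3, 9], []), (-926647680, [5, 7], []), (32285532720, [0, 0], [1, 9]),
  (8697669540, [0, 0], [3, 7]), (732222960, [0, 0], [5, 5]), (-3398234112, [0, 0, 1, 9], []),
  (-916108032, [0, 0, 3, 7], []), (85314264, [0, 0, 5, 5], []), (-6876724344, [0, 1, 2, 7], []),
  (-817537224, [0, 2, 3, 5], []), (-5658256800, [0, 4], [1, 5]), (2969472016, [0, 1, 4, 5], []),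
  (-407672272, [0, 3, 3, 4], []), (2630628336, [0, 1, 3, 6], []), (-1281390432, [0, 1, 1, 8], []),
  (-71717778720, [0, 12], []), (741153728, [1, 2, 2, 5], []), (43786834, [2, 2, 3, 3], []),
  (76123656, [1, 2, 3, 4], []), (80225208, [1, 1, 2, 6], []), (3756588720, [2, 10], []),
  (-26741736, [1, 1, 4, 4], []), (-480773760, [4, 8], []), (59466150, [6, 6], []),
  (-537269040, [1, 1], [0, 8]), (-1657870620, [1, 1], [2, 6]), (-28174446720, [1, 13], []),
  (1681980720, [3, 11], []), (-941690400, [5, 9], []), (-545387850, [7, 7], []),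
  (4304653920, [0, 0], [1, 11]), (2600213280, [0, 0], [3, 9]), (1120357560, [0, 0], [5, 7]),
  (1320137280, [0, 0, 1, 11], []), (202077120, [0, 0, 3, 9], []), (-153336960, [0, 0, 5, 7], []),
  (-3745143360, [0, 1, 2, 9], []), (-692643000, [0, 2, 3, 7], []), (-2838805200, [0, 4], [1, 7]),
  (1977370080, [0, 1, 4, 7], []), (32921280, [0, 3, 4, 5], []), (252609840, [0, 1, 5, 6], []),
  (-156401280, [0, 3, 3, 6], []), (-805953120, [0, 1, 3, 8], []),
  (-1203995520, [0, 1, 1, 10], []), (-59876191200, [0, 14], []), (-1749686400, [0, 1], [0, 11]),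
  (1711150560, [0, 1], [2, 9]), (-888375600, [0, 1], [4, 7]), (175467600, [0, 1], [5, 6]),
  (176047200, [0, 1], [3, 8]), (517029240, [1, 2, 2, 7], []), (-10973760, [2, 2, 3, 5], []),
  (-47564160, [1, 2, 4, 5], []), (17377920, [2, 3, 3, 4], []), (32921280, [1, 2, 3, 6], []),
  (-154089600, [1, 1, 2, 8], []), (3558446400, [2, 12], []), (-10973760, [1, 3, 4, 4], []),
  (134973600, [4, 10], []), (-339372240, [6, 8], []), (8621455920, [1, 1], [0, 10]),
  (1173648000, [1, 1], [2, 8]), (-24838766400, [1, 15], []), (1772752800, [3, 13], []),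
  (-266548800, [5, 11], []), (-871851120, [7, 9], []), (-8335131840, [0, 0], [1, 13]),
  (-819954240, [0, 0], [3, 11]), (234024000, [0, 0], [5, 9]), (81678240, [0, 0], [7, 7]),
  (874944000, [0, 0, 1, 13], []), (105907200, [0, 0, 3, 11], []), (-44271360, [0, 0, 5, 9], []),
  (635040, [0, 0, 7, 7], []), (922582080, [0, 1, 2, 11], []), (-80001600, [0, 2, 3, 9], []),
  (-54875520, [0, 2, 5, 7], []), (222405120, [0, 4], [1, 9]), (-137188800, [0, 4], [3, 7]),
  (-138509952, [0, 1, 4, 9], []), (74628288, [0, 3, 4, 7], []), (-6584256, [0, 4, 5, 5], []),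
  (158052384, [0, 1, 6, 7], []), (9876384, [0, 3, 5, 6], []), (448670208, [0, 1, 5, 8], []),
  (125551104, [0, 3, 3, 8], []), (-1080515520, [0, 1, 3, 10], []),
  (-246960000, [0, 1, 1, 12], []), (-27986165760, [0, 16], []), (-3412416, [1, 2, 2, 9], []),
  (20853504, [2, 2, 3, 7], []), (2194752, [2, 2, 5, 5], []), (-17561376, [1, 2, 4, 7], []),
  (-1097376, [2, 3, 4, 5], []), (-35122752, [1, 2, 5, 6], []), (7134624, [2, 3, 3, 6], []),
  (-154089600, [1, 2, 3, 8], []), (-41160000, [1, 1, 2, 10], []), (2948490720, [2, 14], []),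
  (11707584, [1, 4, 4, 5], []), (-2378208, [3, 3, 4, 4], []), (-544211520, [4, 12], []),
  (-84927840, [6, 10], []), (67968960, [8, 8], []), (4846786560, [1, 1], [0, 12]),
  (1193021760, [1, 1], [2, 10]), (154089600, [1, 1], [4, 8]), (-990380160, [1, 5], [0, 8]),
  (-11729141760, [1, 17], []), (1114283520, [3, 15], []), (-333957120, [5, 13], []),
  (217580160, [7, 11], []), (-466548096, [9, 9], []), (-3468729600, [0, 0], [1, 15]),
  (-435859200, [0, 0], [3, 13]), (-101673600, [0, 0], [5, 11]), (11612160, [0, 0], [7, 9]),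
  (-58060800, [0, 0, 3, 13], []), (19353600, [0, 0, 5, 11], []), (-11612160, [0, 0, 7, 9], []),
  (933004800, [0, 1, 2, 13], []), (82320000, [0, 2, 3, 11], []), (493920000, [0, 4], [1, 11]),
  (-311001600, [0, 1, 4, 11], []), (-109751040, [0, 1, 6, 9], []), (98784000, [0, 1, 7, 8], []),
  (82320000, [0, 1, 5, 10], []), (41160000, [0, 3, 3, 10], []), (-246960000, [0, 1, 3, 12], []),
  (-5554483200, [0, 18], []), (406425600, [0, 1], [0, 15]), (-439084800, [0, 1], [2, 13]),
  (146361600, [0, 1], [4, 11]), (109751040, [0, 1], [6, 9]), (-98784000, [0, 1], [7, 8]),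
  (-82320000, [1, 2, 2, 11], []), (-41160000, [1, 2, 3, 10], []), (958675200, [2, 16], []),
  (-349440000, [4, 14], []), (71366400, [6, 12], []), (864360000, [1, 1], [0, 14]),
  (246960000, [1, 1], [2, 12]), (41160000, [1, 1], [4, 10]), (-246960000, [1, 5], [0, 10]),
  (-2303078400, [1, 19], []), (255897600, [3, 17], []), (-63974400, [5, 15], []),
  (39916800, [7, 13], []), (-87816960, [9, 11], [])]

theorem check6 : check 2 140 t6P cert6 = true := by decide +kernel

noncomputable def cert7 : List (ℤ × List ℕ × List ℕ) := [
  (-2010, [3, 5], []), (-60, [0, 1], [1, 5]), (3510, [0, 1, 1, 5], []), (-4892, [3, 8], []),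
  (-13488, [5, 6], []), (-8670, [1, 1], [0, 5]), (-5720, [0, 1], [1, 8]), (2040, [0, 1], [4, 5]),
  (50300, [0, 1, 1, 8], []), (375, [0, 1, 4, 5], []), (345, [1, 1, 3, 5], []),
  (2376, [3, 11], []), (-42400, [6, 8], []), (-29586, [5, 9], []), (-148500, [1, 1], [0, 8]),
  (-2760, [1, 1], [3, 5]), (-42780, [0, 1], [1, 11]), (8800, [0, 1], [4, 8]),
  (4260, [0, 1], [5, 7]), (196590, [0, 1, 1, 11], []), (23810, [0, 1, 4, 8], []),
  (-2880, [0, 1, 5, 7], []), (-345, [0, 4, 4, 5], []), (-2070, [0, 5], [1, 7]),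
  (3990, [1, 1, 3, 8], []), (345, [1, 3, 4, 5], []), (10944, [3, 14], []), (-19296, [6, 11], []),
  (-106604, [8, 9], []), (-26748, [5, 12], []), (-720495, [1, 1], [0, 11]),
  (-36600, [1, 1], [3, 8]), (-345, [1, 1], [5, 6]), (-103392, [0, 1], [1, 14]),
  (-8460, [0, 1], [4, 11]), (23640, [0, 1], [7, 8]), (2160, [0, 1], [5, 10]),
  (319152, [0, 1, 1, 14], []), (126810, [0, 1, 4, 11], []), (-7680, [0, 1, 7, 8], []),
  (-2160, [0, 1, 5, 10], []), (-3990, [0, 4, 4, 8], []), (-23940, [0, 8], [1, 7]),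
  (11820, [1, 1, 3, 11], []), (3990, [1, 3, 4, 8], []), (5760, [3, 17], []), (32256, [6, 14], []),
  (-91800, [9, 11], []), (-105576, [8, 12], []), (-8640, [5, 15], []),
  (-1566300, [1, 1], [0, 14]), (-130170, [1, 1], [3, 11]), (-3990, [1, 1], [6, 8]),
  (-100800, [0, 1], [1, 17]), (-69984, [0, 1], [4, 14]), (45840, [0, 1], [7, 11]),
  (9120, [0, 1], [8, 10]), (232800, [0, 1, 1, 17], []), (246864, [0, 1, 4, 14], []),
  (-69480, [0, 1, 7, 11], []), (-9120, [0, 1, 8, 10], []), (-11820, [0, 4, 4, 11], []),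
  (12960, [1, 1, 3, 14], []), (11820, [1, 3, 4, 11], []), (23040, [6, 17], []),
  (13248, [9, 14], []), (-116208, [11, 12], []), (-36480, [8, 15], []),
  (-1744680, [1, 1], [0, 17]), (-189840, [1, 1], [3, 14]), (-11820, [1, 1], [6, 11]),
  (70920, [1, 7], [0, 11]), (-34560, [0, 1], [1, 20]), (-89280, [0, 1], [4, 17]),
  (38016, [0, 1], [7, 14]), (11520, [0, 1], [10, 11]), (63360, [0, 1, 1, 20], []),
  (206880, [0, 1, 4, 17], []), (-63936, [0, 1, 7, 14], []), (-11520, [0, 1, 10, 11], []),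
  (-12960, [0, 4, 4, 14], []), (4800, [1, 1, 3, 17], []), (12960, [1, 3, 4, 14], []),
  (28800, [9, 17], []), (-26496, [12, 14], []), (-46080, [11, 15], []),
  (-980640, [1, 1], [0, 20]), (-122400, [1, 1], [3, 17]), (-12960, [1, 1], [6, 14]),
  (77760, [1, 7], [0, 14]), (-34560, [0, 1], [4, 20]), (11520, [0, 1], [7, 17]),
  (4608, [0, 1], [10, 14]), (63360, [0, 1, 4, 20], []), (-21120, [0, 1, 7, 17], []),
  (-4608, [0, 1, 10, 14], []), (-4800, [0, 4, 4, 17], []), (4800, [1, 3, 4, 17], []),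
  (11520, [12, 17], []), (-18432, [14, 15], []), (-221760, [1, 1], [0, 23]),
  (-28800, [1, 1], [3, 20]), (-4800, [1, 1], [6, 17]), (28800, [1, 7], [0, 17])]

theorem check7 : check 3 2 t7P cert7 = true := by decide +kernel

end HeisCert

namespace HeisCert

section Relations

variable {V : Type} [AddCommGroup V] [Module ℂ V] {W : Type} [AddCommGroup W] [Module ℂ W]
  {ℓ : ℕ} (S : HeisenbergPlusSetting ℓ V W) (N : ℕ) (κ : ℕ → Fin ℓ)

theorem ev_oneP : ev S.A S.hgen N κ oneP = S.ι S.B.one := by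
  rw [S.fixedSub.map_one]; simp [oneP, ev, evW]

variable (hN : 0 < N)
include hN

theorem evW_letter (c m : ℕ) (hc : c < N) (w : List ℕ) :
    evW S.A S.hgen N κ ((c + N * m) :: w) =
      S.A.Y (S.hgen (κ c)) (-((m : ℤ) + 1)) (evW S.A S.hgen N κ w) := by
  rw [evW, Nat.add_mul_mod_self_left, Nat.mod_eq_of_lt hc, Nat.add_mul_div_left _ _ hN,
    Nat.div_eq_of_lt hc, zero_add]
  congr 2; ring

theorem ev_sP (c d m n : ℕ) (hc : c < N) (hd : d < N) :
    ev S.A S.hgen N κ (sP N c d m n) = SV S.A S.hgen (κ c) (κ d) (m + 1) (n + 1) := by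
  rw [sP, ev_cons, ev_nil, evW_ins S.A S.hgen N κ S.heis, evW_letter S N κ hN c m hc,
    evW_letter S N κ hN d n hd]
  simp [SV, evW]

theorem ev_combP (c d : ℕ) (hc : c < N) (hd : d < N) (x y z t : ℤ) :
    ev S.A S.hgen N κ (combP N c d x y z t) =
      (x : ℂ) • SV S.A S.hgen (κ c) (κ d) 1 2 + (y : ℂ) • SV S.A S.hgen (κ c) (κ d) 1 3
      + (z : ℂ) • SV S.A S.hgen (κ c) (κ d) 1 4 + (t : ℂ) • SV S.A S.hgen (κ c) (κ d) 1 5 := by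
  simp only [combP, ev_append, ev_scale, ev_sP S N κ hN _ _ _ _ hc hd]
  norm_num
  abel

variable (s : Fin ℓ → Fin ℓ → ℤ → ℤ → W)
  (hs : ∀ a b m n, S.ι (s a b m n) = SV S.A S.hgen a b m n)
include hs

theorem iota_La (c d : ℕ) (hc : c < N) (hd : d < N) :
    S.ι (LamW s (κ c) (κ d)) = ev S.A S.hgen N κ (laP N c d) := by
  rw [laP, ev_combP S N κ hN c d hc hd]
  simp [LamW, hs]

omit hN in
theorem iota_Eu (c d : ℕ) (hc : c < 2) (hd : d < 2) :
    S.ι (EuW s (κ c) (κ d)) = ev S.A S.hgen 2 κ (euP c d) := by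
  rw [euP, ev_combP S 2 κ (by norm_num) c d hc hd]
  simp [EuW, hs]

omit hN in
theorem iota_Et (c d : ℕ) (hc : c < 2) (hd : d < 2) :
    S.ι (EtW s (κ c) (κ d)) = ev S.A S.hgen 2 κ (etP c d) := by
  rw [etP, ev_combP S 2 κ (by norm_num) c d hc hd]
  simp only [EtW, hs, map_add, map_smul]
  push_cast
  module

omit hs
variable (ow : Fin ℓ → W) (how : ∀ a, S.ι (ow a) = omegaV S.A S.hgen a)
    (Jw : Fin ℓ → W) (hJw : ∀ a, S.ι (Jw a) = JV S.A S.hgen a)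
include how

theorem iota_om (c : ℕ) (hc : c < N) :
    S.ι (ow (κ c)) = (1 / 2 : ℂ) • ev S.A S.hgen N κ (omP N c) := by
  rw [omP, ev_sP S N κ hN _ _ _ _ hc hc, how, omegaV]
  norm_num

include hJw

theorem iota_H (hκ : ∀ i j, i < N → j < N → κ i = κ j → i = j) (c : ℕ) (hc : c < N) :
    S.ι (Jw (κ c) + ow (κ c) - (4 : ℂ) • S.B.star (ow (κ c)) (ow (κ c))) =
      (1 / 2 : ℂ) • ev S.A S.hgen N κ (hP N c) := by
  have h4 : evW S.A S.hgen N κ [c, c, c, c] = S.A.Y (S.hgen (κ c)) (-1) (S.A.Y (S.hgen (κ c)) (-1)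
      (S.A.Y (S.hgen (κ c)) (-1) (S.A.Y (S.hgen (κ c)) (-1) S.A.one))) := by
    have h := fun w => evW_letter S N κ hN c 0 hc w
    simp only [mul_zero, add_zero, Nat.cast_zero, zero_add] at h
    rw [h, h, h, h]; rfl
  rw [map_sub, map_add, map_smul, iota_star, hJw, iota_om S N κ hN ow how c hc, hP, jP]
  simp only [ev_append, ev_scale, ev_starP S.A S.hgen N κ S.heis hN hκ,
    ev_sP S N κ hN _ _ _ _ hc hc, ev_cons, ev_nil, h4, JV, map_smul, LinearMap.smul_apply]
  norm_num
  module

end Relations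

end HeisCert

/-- Proposition 6.2.1. Set `H_a = J_a + ω_a - 4ω_a²` in
`A(𝓗⁺)`. For distinct `a,b` (and `c` distinct from both in the last relation)
the listed relations hold in `A(𝓗⁺)`, where `E^u_{aa} = E^u_{ab} * E^u_{ba}`,
`E^t_{aa} = E^t_{ab} * E^t_{ba}` are the diagonal matrix elements. -/
theorem statement19 (ℓ : ℕ) {V W : Type} [AddCommGroup V] [Module ℂ V]
    [AddCommGroup W] [Module ℂ W] (S : HeisenbergPlusSetting ℓ V W)
    (s : Fin ℓ → Fin ℓ → ℤ → ℤ → W)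
    (hs : ∀ a b m n, S.ι (s a b m n) = SV S.A S.hgen a b m n)
    (ow : Fin ℓ → W) (how : ∀ a, S.ι (ow a) = omegaV S.A S.hgen a)
    (Jw : Fin ℓ → W) (hJw : ∀ a, S.ι (Jw a) = JV S.A S.hgen a)
    (a b : Fin ℓ) (hab : a ≠ b) :
    let H : Fin ℓ → W := fun e => Jw e + ow e - (4 : ℂ) • S.B.star (ow e) (ow e)
    let Euaa : W := S.B.star (EuW s a b) (EuW s b a)
    let Eubb : W := S.B.star (EuW s b a) (EuW s a b)
    let Etaa : W := S.B.star (EtW s a b) (EtW s b a)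
    let Etbb : W := S.B.star (EtW s b a) (EtW s a b)
    -- (70H_a + 1188ω_a² - 585ω_a + 27)H_a = 0
    (S.B.star ((70 : ℂ) • H a + (1188 : ℂ) • S.B.star (ow a) (ow a)
        - (585 : ℂ) • ow a + (27 : ℂ) • S.B.one) (H a) ∈ S.B.Osub) ∧
    -- (ω_a - 1)(ω_a - 1/16)(ω_a - 9/16) H_a = 0
    (S.B.star (ow a - S.B.one) (S.B.star (ow a - (1 / 16 : ℂ) • S.B.one)
        (S.B.star (ow a - (9 / 16 : ℂ) • S.B.one) (H a))) ∈ S.B.Osub) ∧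
    -- -(2/9)H_a + (2/9)H_b = 2E^u_{aa} - 2E^u_{bb} + (1/4)E^t_{aa} - (1/4)E^t_{bb}
    ((-(2 / 9 : ℂ)) • H a + (2 / 9 : ℂ) • H b
      - ((2 : ℂ) • Euaa - (2 : ℂ) • Eubb + (1 / 4 : ℂ) • Etaa - (1 / 4 : ℂ) • Etbb)
        ∈ S.B.Osub) ∧
    -- -(4/135)(2ω_a + 13)H_a + (4/135)(2ω_b + 13)H_b
    --   = 4E^u_{aa} - 4E^u_{bb} + (15/32)E^t_{aa} - (15/32)E^t_{bb}
    ((-(4 / 135 : ℂ)) • S.B.star ((2 : ℂ) • ow a + (13 : ℂ) • S.B.one) (H a)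
      + (4 / 135 : ℂ) • S.B.star ((2 : ℂ) • ow b + (13 : ℂ) • S.B.one) (H b)
      - ((4 : ℂ) • Euaa - (4 : ℂ) • Eubb + (15 / 32 : ℂ) • Etaa
          - (15 / 32 : ℂ) • Etbb) ∈ S.B.Osub) ∧
    -- ω_b H_a = -(2/15)(ω_a - 1)H_a + (1/15)(ω_b - 1)H_b
    (S.B.star (ow b) (H a)
      - ((-(2 / 15 : ℂ)) • S.B.star (ow a - S.B.one) (H a)
          + (1 / 15 : ℂ) • S.B.star (ow b - S.B.one) (H b)) ∈ S.B.Osub) ∧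
    -- Λ_{ab}² = 4ω_aω_b - (1/9)(H_a + H_b) - (E^u_{aa} + E^u_{bb}) - (1/4)(E^t_{aa} + E^t_{bb})
    (S.B.star (LamW s a b) (LamW s a b)
      - ((4 : ℂ) • S.B.star (ow a) (ow b) - (1 / 9 : ℂ) • (H a + H b)
          - (Euaa + Eubb) - (1 / 4 : ℂ) • (Etaa + Etbb)) ∈ S.B.Osub) ∧
    -- Λ_{ab} * Λ_{bc} = 2ω_b * Λ_{ac} for a,b,c distinct
    (∀ c : Fin ℓ, a ≠ c → b ≠ c →
      S.B.star (LamW s a b) (LamW s b c)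
        - (2 : ℂ) • S.B.star (ow b) (LamW s a c) ∈ S.B.Osub) := by
  intro H Euaa Eubb Etaa Etbb
  let κ : ℕ → Fin ℓ := fun i => if i = 0 then a else b
  have hκ : ∀ i j, i < 2 → j < 2 → κ i = κ j → i = j := by
    intro i j hi hj h
    interval_cases i <;> interval_cases j <;> simp [κ, hab, hab.symm] at h ⊢
  have h2 : 0 < 2 := by norm_num
  have hH0 : S.ι (H a) = (1 / 2 : ℂ) • HeisCert.ev S.A S.hgen 2 κ (HeisCert.hP 2 0) :=
    HeisCert.iota_H S 2 κ h2 ow how Jw hJw hκ 0 (by norm_num)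
  have hH1 : S.ι (H b) = (1 / 2 : ℂ) • HeisCert.ev S.A S.hgen 2 κ (HeisCert.hP 2 1) :=
    HeisCert.iota_H S 2 κ h2 ow how Jw hJw hκ 1 (by norm_num)
  have ho0 : S.ι (ow a) = (1 / 2 : ℂ) • HeisCert.ev S.A S.hgen 2 κ (HeisCert.omP 2 0) :=
    HeisCert.iota_om S 2 κ h2 ow how 0 (by norm_num)
  have ho1 : S.ι (ow b) = (1 / 2 : ℂ) • HeisCert.ev S.A S.hgen 2 κ (HeisCert.omP 2 1) :=
    HeisCert.iota_om S 2 κ h2 ow how 1 (by norm_num)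
  have hone := (HeisCert.ev_oneP S 2 κ).symm
  have hL : S.ι (LamW s a b) = HeisCert.ev S.A S.hgen 2 κ (HeisCert.laP 2 0 1) :=
    HeisCert.iota_La S 2 κ h2 s hs 0 1 (by norm_num) (by norm_num)
  have hu01 : S.ι (EuW s a b) = HeisCert.ev S.A S.hgen 2 κ (HeisCert.euP 0 1) :=
    HeisCert.iota_Eu S κ s hs 0 1 (by norm_num) (by norm_num)
  have hu10 : S.ι (EuW s b a) = HeisCert.ev S.A S.hgen 2 κ (HeisCert.euP 1 0) :=
    HeisCert.iota_Eu S κ s hs 1 0 (by norm_num) (by norm_num)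
  have ht01 : S.ι (EtW s a b) = HeisCert.ev S.A S.hgen 2 κ (HeisCert.etP 0 1) :=
    HeisCert.iota_Et S κ s hs 0 1 (by norm_num) (by norm_num)
  have ht10 : S.ι (EtW s b a) = HeisCert.ev S.A S.hgen 2 κ (HeisCert.etP 1 0) :=
    HeisCert.iota_Et S κ s hs 1 0 (by norm_num) (by norm_num)
  have hst := HeisCert.ev_starP S.A S.hgen 2 κ S.heis h2 hκ
  have hEu : S.ι Euaa = HeisCert.ev S.A S.hgen 2 κ HeisCert.euaa := by
    rw [HeisCert.euaa, hst, HeisCert.iota_star, hu01, hu10]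
  have hEu' : S.ι Eubb = HeisCert.ev S.A S.hgen 2 κ HeisCert.eubb := by
    rw [HeisCert.eubb, hst, HeisCert.iota_star, hu01, hu10]
  have hEt : S.ι Etaa = HeisCert.ev S.A S.hgen 2 κ HeisCert.etaa := by
    rw [HeisCert.etaa, hst, HeisCert.iota_star, ht01, ht10]
  have hEt' : S.ι Etbb = HeisCert.ev S.A S.hgen 2 κ HeisCert.etbb := by
    rw [HeisCert.etbb, hst, HeisCert.iota_star, ht01, ht10]
  clear_value H Euaa Eubb Etaa Etbb
  refine ⟨HeisCert.check_sound S 2 κ h2 hκ _ _ _ HeisCert.check1 _ 4 (by norm_num) ?_, ?_⟩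
  · simp only [HeisCert.t1P, HeisCert.ev_append, HeisCert.ev_scale, hst, HeisCert.iota_star,
      map_add, map_sub, map_smul, LinearMap.add_apply, LinearMap.sub_apply, LinearMap.smul_apply,
      hH0, hH1, ho0, ho1, hone, hL, hEu, hEu', hEt, hEt']
    push_cast
    module
  refine ⟨HeisCert.check_sound S 2 κ h2 hκ _ _ _ HeisCert.check2 _ 1024 (by norm_num) ?_, ?_⟩
  · simp only [HeisCert.t2P, HeisCert.ev_append, HeisCert.ev_scale, hst, HeisCert.iota_star,
      map_add, map_sub, map_smul, LinearMap.add_apply, LinearMap.sub_apply, LinearMap.smul_apply,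
      hH0, hH1, ho0, ho1, hone, hL, hEu, hEu', hEt, hEt']
    push_cast
    module
  refine ⟨HeisCert.check_sound S 2 κ h2 hκ _ _ _ HeisCert.check3 _ 36 (by norm_num) ?_, ?_⟩
  · simp only [HeisCert.t3P, HeisCert.ev_append, HeisCert.ev_scale, hst, HeisCert.iota_star,
      map_add, map_sub, map_smul, LinearMap.add_apply, LinearMap.sub_apply, LinearMap.smul_apply,
      hH0, hH1, ho0, ho1, hone, hL, hEu, hEu', hEt, hEt']
    push_cast
    module
  refine ⟨HeisCert.check_sound S 2 κ h2 hκ _ _ _ HeisCert.check4 _ 4320 (by norm_num) ?_, ?_⟩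
  · simp only [HeisCert.t4P, HeisCert.ev_append, HeisCert.ev_scale, hst, HeisCert.iota_star,
      map_add, map_sub, map_smul, LinearMap.add_apply, LinearMap.sub_apply, LinearMap.smul_apply,
      hH0, hH1, ho0, ho1, hone, hL, hEu, hEu', hEt, hEt']
    push_cast
    module
  refine ⟨HeisCert.check_sound S 2 κ h2 hκ _ _ _ HeisCert.check5 _ 60 (by norm_num) ?_, ?_⟩
  · simp only [HeisCert.t5P, HeisCert.ev_append, HeisCert.ev_scale, hst, HeisCert.iota_star,
      map_add, map_sub, map_smul, LinearMap.add_apply, LinearMap.sub_apply, LinearMap.smul_apply,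
      hH0, hH1, ho0, ho1, hone, hL, hEu, hEu', hEt, hEt']
    push_cast
    module
  refine ⟨HeisCert.check_sound S 2 κ h2 hκ _ _ _ HeisCert.check6 _ 36 (by norm_num) ?_, ?_⟩
  · simp only [HeisCert.t6P, HeisCert.ev_append, HeisCert.ev_scale, hst, HeisCert.iota_star,
      map_add, map_sub, map_smul, LinearMap.add_apply, LinearMap.sub_apply, LinearMap.smul_apply,
      hH0, hH1, ho0, ho1, hone, hL, hEu, hEu', hEt, hEt']
    push_cast
    module
  intro c hac hbc
  let κ' : ℕ → Fin ℓ := fun i => if i = 0 then a else if i = 1 then b else c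
  have hκ' : ∀ i j, i < 3 → j < 3 → κ' i = κ' j → i = j := by
    intro i j hi hj h
    interval_cases i <;> interval_cases j <;>
      simp [κ', hab, hab.symm, hac, hac.symm, hbc, hbc.symm] at h ⊢
  have h3 : 0 < 3 := by norm_num
  have hst' := HeisCert.ev_starP S.A S.hgen 3 κ' S.heis h3 hκ'
  have ho : S.ι (ow b) = (1 / 2 : ℂ) • HeisCert.ev S.A S.hgen 3 κ' (HeisCert.omP 3 1) :=
    HeisCert.iota_om S 3 κ' h3 ow how 1 (by norm_num)
  have hL01 : S.ι (LamW s a b) = HeisCert.ev S.A S.hgen 3 κ' (HeisCert.laP 3 0 1) :=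
    HeisCert.iota_La S 3 κ' h3 s hs 0 1 (by norm_num) (by norm_num)
  have hL12 : S.ι (LamW s b c) = HeisCert.ev S.A S.hgen 3 κ' (HeisCert.laP 3 1 2) :=
    HeisCert.iota_La S 3 κ' h3 s hs 1 2 (by norm_num) (by norm_num)
  have hL02 : S.ι (LamW s a c) = HeisCert.ev S.A S.hgen 3 κ' (HeisCert.laP 3 0 2) :=
    HeisCert.iota_La S 3 κ' h3 s hs 0 2 (by norm_num) (by norm_num)
  refine HeisCert.check_sound S 3 κ' h3 hκ' _ _ _ HeisCert.check7 _ 1 (by norm_num) ?_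
  simp only [HeisCert.t7P, HeisCert.ev_append, HeisCert.ev_scale, hst', HeisCert.iota_star,
    map_sub, map_smul, LinearMap.smul_apply, ho, hL01, hL12, hL02]
  push_cast
  module
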